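/- arXiv:2211.11135 — 3 statements merged into one kernel-verified Lean document; each statement's English description precedes it below -/
import Mathlib

section
/- Let σ ≥ 1 and l > 1, let D' ⊂ ℝⁿ be a closed set, let ω ∈ C(D', ℝⁿ) with finite Lipschitz norm |ω|_{L(D')}, and let g: 𝕋ⁿ × ℝ⁺ × D' → ℝ belong to D⁺_σ (i.e. g is continuous and g^t_{p₀} ∈ C^σ(𝕋ⁿ) for all (t,p₀)) with |g|⁺_{σ,l+1,L(D')} < ∞. Then κ(θ,t;p₀) = −∫_t^{+∞} g(θ + ω(p₀)(τ−t), τ; p₀) dτ is the unique solution in D⁺_σ of the homological equation ω(p₀)·∂_θ κ + ∂_t κ = g satisfying lim_{t→+∞}|κ^t_{p₀}|_{C^0} = 0 for each fixed p₀ ∈ D', and it satisfies |κ|⁺_{σ,l,L(D')} ≤ C(n, l, |ω|_{L(D')}) |g|⁺_{σ,l+1,L(D')} for a constant depending only on n, l and |ω|_{L(D')}. -/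
open scoped ENNReal NNReal Topology
open Filter Metric Set MeasureTheory

noncomputable section

namespace Bias

/-- ℝⁿ, the model space; functions on the torus 𝕋ⁿ = ℝⁿ/ℤⁿ are modelled as
ℤⁿ-periodic functions on ℝⁿ. -/
abbrev E (n : ℕ) := EuclideanSpace ℝ (Fin n)

variable {n : ℕ}

/-- a lattice point of ℤⁿ inside ℝⁿ -/
def latt (k : Fin n → ℤ) : E n := (EuclideanSpace.equiv (Fin n) ℝ).symm fun i => (k i : ℝ)

/-- distance on the torus ℝⁿ/ℤⁿ between (representatives of) two points -/
def distT (x y : E n) : ℝ := ⨅ k : Fin n → ℤ, ‖x - y - latt k‖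

/-- fundamental domain [0,1)ⁿ of the torus -/
def fund (n : ℕ) : Set (E n) := {x | ∀ i, 0 ≤ x i ∧ x i < 1}

variable {E' F : Type*} [NormedAddCommGroup E'] [NormedSpace ℝ E']
  [NormedAddCommGroup F] [NormedSpace ℝ F]

/-- `C^k` norm of `f` on the set `s` (with extended-real value). -/
def cNormOn (k : ℕ) (s : Set E') (f : E' → F) : ℝ≥0∞ :=
  ⨆ i : Fin (k + 1), ⨆ x ∈ s, (‖iteratedFDerivWithin ℝ (i : ℕ) f s x‖₊ : ℝ≥0∞)

/-- Hölder `C^σ` norm of `f` on the set `s`: the `C^⌊σ⌋` norm, plus — when σ is not an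
integer — the (σ - ⌊σ⌋)-Hölder seminorm of the ⌊σ⌋-th derivative. -/
def holderNormOn (σ : ℝ) (s : Set E') (f : E' → F) : ℝ≥0∞ :=
  cNormOn ⌊σ⌋₊ s f +
    if (⌊σ⌋₊ : ℝ) = σ then 0 else
      ⨆ x ∈ s, ⨆ y ∈ s, ⨆ _ : x ≠ y,
        ENNReal.ofReal (‖iteratedFDerivWithin ℝ ⌊σ⌋₊ f s x -
          iteratedFDerivWithin ℝ ⌊σ⌋₊ f s y‖ / ‖x - y‖ ^ (σ - (⌊σ⌋₊ : ℝ)))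

/-- membership in the Hölder class `C^σ` on `s`. -/
def HolderOn (σ : ℝ) (s : Set E') (f : E' → F) : Prop :=
  ContDiffOn ℝ ⌊σ⌋₊ f s ∧ holderNormOn σ s f < ⊤

/-- Lipschitz norm of a map on a set. -/
def lipNormOn (s : Set E') (f : E' → F) : ℝ≥0∞ :=
  (⨆ x ∈ s, ⨆ y ∈ s, ⨆ _ : x ≠ y, ENNReal.ofReal (‖f x - f y‖ / ‖x - y‖)) +
    ⨆ x ∈ s, (‖f x‖₊ : ℝ≥0∞)

/-- Lipschitz (in the parameter) norm of a parametrised family `G z x` (`x` the parameter). -/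
def lipParamNorm {α : Type*} (S : Set α) (A : Set (E n)) (G : α → E n → F) : ℝ≥0∞ :=
  (⨆ z ∈ S, ⨆ x ∈ A, ⨆ y ∈ A, ⨆ _ : x ≠ y, ENNReal.ofReal (‖G z x - G z y‖ / ‖x - y‖)) +
    ⨆ z ∈ S, ⨆ x ∈ A, (‖G z x‖₊ : ℝ≥0∞)

/-- the time weights 1 + |t|^l  and  1 + |t|^(l-1) (equal to 1 for l = 0). -/
def w1 (l t : ℝ) : ℝ := if l = 0 then 1 else 1 + |t| ^ l
def w2 (l t : ℝ) : ℝ := if l = 0 then 1 else 1 + |t| ^ (l - 1)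

/-- ℤⁿ-periodicity in the angular variable. -/
def Per (f : E n → E n → ℝ → F) : Prop :=
  ∀ (q p : E n) (t : ℝ) (k : Fin n → ℤ), f (q + latt k) p t = f q p t

/-- partial derivative in the action/parameter variable `p`. -/
def pderiv (f : E n → E n → ℝ → F) (q p : E n) (t : ℝ) : E n →L[ℝ] F :=
  fderiv ℝ (fun p' => f q p' t) p

/-- i-th partial derivative in the angular variable `q`. -/
def qderiv (i : ℕ) (f : E n → E n → ℝ → F) :
    E n → E n → ℝ → ContinuousMultilinearMap ℝ (fun _ : Fin i => E n) F :=
  fun q p t => iteratedFDeriv ℝ i (fun q' => f q' p t) q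

/-- the space `B_σ` of functions on 𝕋ⁿ × A × ℝ. -/
def MemB (σ : ℝ) (A : Set (E n)) (f : E n → E n → ℝ → F) : Prop :=
  ContinuousOn (fun x : E n × E n × ℝ => f x.1 x.2.1 x.2.2) (univ ×ˢ (A ×ˢ univ)) ∧
  ContinuousOn (fun x : E n × E n × ℝ => pderiv f x.1 x.2.1 x.2.2) (univ ×ˢ (A ×ˢ univ)) ∧
  Per f ∧ ∀ p ∈ A, ∀ t : ℝ, HolderOn σ univ fun q => f q p t

/-- the weighted norm `|f|_{σ,l}`. -/
def wnormB (σ l : ℝ) (A : Set (E n)) (f : E n → E n → ℝ → F) : ℝ≥0∞ :=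
  (⨆ p ∈ A, ⨆ t : ℝ, holderNormOn σ univ (fun q => f q p t) * ENNReal.ofReal (w1 l t)) +
    ⨆ p ∈ A, ⨆ t : ℝ, ⨆ q : E n, (‖pderiv f q p t‖₊ : ℝ≥0∞) * ENNReal.ofReal (w2 l t)

/-- the space `B̄_{σ,k}`. -/
def MemBbar (σ : ℝ) (k : ℕ) (A : Set (E n)) (f : E n → E n → ℝ → F) : Prop :=
  ∀ i : ℕ, i ≤ k → MemB (σ + k - i) A (qderiv i f)

/-- the weighted norm `‖f‖_{σ,k,l}`. -/
def wnormBbar (σ : ℝ) (k : ℕ) (l : ℝ) (A : Set (E n)) (f : E n → E n → ℝ → F) : ℝ≥0∞ :=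
  ⨆ i : Fin (k + 1), wnormB (σ + k - (i : ℕ)) l A (qderiv (i : ℕ) f)

/-- the space `D_σ` of functions on 𝕋ⁿ × A × ℝ (Lipschitz setting). -/
def MemD (σ : ℝ) (A : Set (E n)) (f : E n → E n → ℝ → F) : Prop :=
  ContinuousOn (fun x : E n × E n × ℝ => f x.1 x.2.1 x.2.2) (univ ×ˢ (A ×ˢ univ)) ∧
  Per f ∧ ∀ p ∈ A, ∀ t : ℝ, HolderOn σ univ fun q => f q p t

/-- the Lipschitz norm `|f^t|_{L(A)}` of the time-t slice. -/
def lipT (A : Set (E n)) (f : E n → E n → ℝ → F) (t : ℝ) : ℝ≥0∞ :=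
  (⨆ q : E n, ⨆ x ∈ A, ⨆ y ∈ A, ⨆ _ : x ≠ y, ENNReal.ofReal (‖f q x t - f q y t‖ / ‖x - y‖)) +
    ⨆ q : E n, ⨆ p ∈ A, (‖f q p t‖₊ : ℝ≥0∞)

/-- the weighted Lipschitz norm `|f|_{σ,l,L(A)}`. -/
def wnormD (σ l : ℝ) (A : Set (E n)) (f : E n → E n → ℝ → F) : ℝ≥0∞ :=
  (⨆ p ∈ A, ⨆ t : ℝ, holderNormOn σ univ (fun q => f q p t) * ENNReal.ofReal (w1 l t)) +
    ⨆ t : ℝ, lipT A f t * ENNReal.ofReal (w2 l t)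

/-- the space `D̄_{σ,k}`. -/
def MemDbar (σ : ℝ) (k : ℕ) (A : Set (E n)) (f : E n → E n → ℝ → F) : Prop :=
  ∀ i : ℕ, i ≤ k → MemD (σ + k - i) A (qderiv i f)

/-- the weighted norm `‖f‖_{σ,k,l,L(A)}`. -/
def wnormDbar (σ : ℝ) (k : ℕ) (l : ℝ) (A : Set (E n)) (f : E n → E n → ℝ → F) : ℝ≥0∞ :=
  ⨆ i : Fin (k + 1), wnormD (σ + k - (i : ℕ)) l A (qderiv (i : ℕ) f)

/-! ### spaces of functions defined for positive times only -/

/-- the space `B⁺_σ` of functions on 𝕋ⁿ × ℝ⁺ × A (argument order: (θ, p₀, t)). -/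
def MemBp (σ : ℝ) (A : Set (E n)) (f : E n → E n → ℝ → F) : Prop :=
  ContinuousOn (fun x : E n × E n × ℝ => f x.1 x.2.1 x.2.2) (univ ×ˢ (A ×ˢ Ici 0)) ∧
  ContinuousOn (fun x : E n × E n × ℝ => pderiv f x.1 x.2.1 x.2.2) (univ ×ˢ (A ×ˢ Ici 0)) ∧
  (∀ (q p : E n), ∀ t ∈ Ici (0:ℝ), ∀ k : Fin n → ℤ, f (q + latt k) p t = f q p t) ∧
  ∀ p ∈ A, ∀ t ∈ Ici (0:ℝ), HolderOn σ univ fun q => f q p t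

/-- the weighted norm `|f|⁺_{σ,l}`. -/
def wnormBp (σ l : ℝ) (A : Set (E n)) (f : E n → E n → ℝ → F) : ℝ≥0∞ :=
  (⨆ p ∈ A, ⨆ t ∈ Ici (0:ℝ), holderNormOn σ univ (fun q => f q p t) * ENNReal.ofReal (w1 l t)) +
    ⨆ p ∈ A, ⨆ t ∈ Ici (0:ℝ), ⨆ q : E n, (‖pderiv f q p t‖₊ : ℝ≥0∞) * ENNReal.ofReal (w2 l t)

/-- the space `D⁺_σ` of functions on 𝕋ⁿ × ℝ⁺ × A (Lipschitz setting). -/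
def MemDp (σ : ℝ) (A : Set (E n)) (f : E n → E n → ℝ → F) : Prop :=
  ContinuousOn (fun x : E n × E n × ℝ => f x.1 x.2.1 x.2.2) (univ ×ˢ (A ×ˢ Ici 0)) ∧
  (∀ (q p : E n), ∀ t ∈ Ici (0:ℝ), ∀ k : Fin n → ℤ, f (q + latt k) p t = f q p t) ∧
  ∀ p ∈ A, ∀ t ∈ Ici (0:ℝ), HolderOn σ univ fun q => f q p t

/-- the weighted Lipschitz norm `|f|⁺_{σ,l,L(A)}`. -/
def wnormDp (σ l : ℝ) (A : Set (E n)) (f : E n → E n → ℝ → F) : ℝ≥0∞ :=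
  (⨆ p ∈ A, ⨆ t ∈ Ici (0:ℝ), holderNormOn σ univ (fun q => f q p t) * ENNReal.ofReal (w1 l t)) +
    ⨆ t ∈ Ici (0:ℝ), lipT A f t * ENNReal.ofReal (w2 l t)

/-! ### Hamiltonian vector fields, embedded tori -/

/-- the Hamiltonian vector field `X_H = (∂_p H, -∂_q H)` of a time-dependent Hamiltonian. -/
def XH (H : E n → E n → ℝ → ℝ) (q p : E n) (t : ℝ) : E n × E n :=
  (gradient (fun p' => H q p' t) p, -gradient (fun q' => H q' p t) q)

/-- a `C^σ` embedding of the torus 𝕋ⁿ into 𝕋ⁿ × B (written in the universal cover). -/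
def TorusEmb (σ : ℝ) (B : Set (E n)) (φ : E n → E n × E n) : Prop :=
  (∀ (q : E n) (k : Fin n → ℤ), φ (q + latt k) = ((φ q).1 + latt k, (φ q).2)) ∧
  (∀ q : E n, (φ q).2 ∈ B) ∧
  HolderOn σ univ (fun q : E n => φ q - (q, (0 : E n))) ∧
  (∀ (q q' : E n) (k : Fin n → ℤ), (φ q).1 = (φ q').1 + latt k → (φ q).2 = (φ q').2 →
    ∃ kk : Fin n → ℤ, q = q' + latt kk)

/-- a positive `C^σ`-asymptotic KAM torus associated to `(X, X₀, φ₀)` with frequency ω: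
a family of `C^σ` embeddings, defined for t ≥ 0, converging in `C^σ` norm to φ₀ as t → +∞
and satisfying `X(φ(q,t),t) = ∂_q φ(q,t) ω + ∂_t φ(q,t)` (expressed along the
characteristics `s ↦ φ^s(q + sω)`). -/
def AsymTorusPos (σ : ℝ) (B : Set (E n)) (X : E n → E n → ℝ → E n × E n)
    (φ₀ : E n → E n × E n) (ω : E n) (φ : ℝ → E n → E n × E n) : Prop :=
  (∀ t ∈ Ici (0:ℝ), TorusEmb σ B (φ t)) ∧
  Tendsto (fun t => holderNormOn σ univ fun q => φ t q - φ₀ q) atTop (𝓝 0) ∧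
  ∀ q : E n, ∀ t ∈ Ici (0:ℝ),
    HasDerivWithinAt (fun s => φ s (q + s • ω))
      (X (φ t (q + t • ω)).1 (φ t (q + t • ω)).2 t) (Ici 0) t

/-- a negative `C^σ`-asymptotic KAM torus. -/
def AsymTorusNeg (σ : ℝ) (B : Set (E n)) (X : E n → E n → ℝ → E n × E n)
    (φ₀ : E n → E n × E n) (ω : E n) (φ : ℝ → E n → E n × E n) : Prop :=
  (∀ t ∈ Iic (0:ℝ), TorusEmb σ B (φ t)) ∧
  Tendsto (fun t => holderNormOn σ univ fun q => φ t q - φ₀ q) atBot (𝓝 0) ∧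
  ∀ q : E n, ∀ t ∈ Iic (0:ℝ),
    HasDerivWithinAt (fun s => φ s (q + s • ω))
      (X (φ t (q + t • ω)).1 (φ t (q + t • ω)).2 t) (Iic 0) t


section Aux

lemma aux_meas_fderiv {V : Type*} [NormedAddCommGroup V] [NormedSpace ℝ V] [FiniteDimensional ℝ V]
    {W : Type*} [NormedAddCommGroup W] [NormedSpace ℝ W] {μ : Measure ℝ} (G : ℝ → V → W)
    (hd : ∀ᵐ τ ∂μ, Differentiable ℝ (G τ))
    (hm : ∀ q, AEStronglyMeasurable (fun τ => G τ q) μ) (q : V) :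
    AEStronglyMeasurable (fun τ => fderiv ℝ (G τ) q) μ := by
  have h1 : ∀ v : V, AEStronglyMeasurable (fun τ => fderiv ℝ (G τ) q v) μ := by
    intro v
    refine aestronglyMeasurable_of_tendsto_ae (u := atTop)
      (f := fun (n : ℕ) τ => (n : ℝ) • (G τ (q + (n : ℝ)⁻¹ • v) - G τ q)) ?_ ?_
    · intro n
      exact ((hm _).sub (hm _)).const_smul _
    · filter_upwards [hd] with τ hτ
      have h := (hτ q).hasFDerivAt.lim v (c := fun n : ℕ => (n : ℝ)) (l := atTop) ?_
      · exact h
      · simpa using tendsto_natCast_atTop_atTop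
  let b := Module.finBasis ℝ V
  have h2 : ∀ τ, fderiv ℝ (G τ) q =
      ∑ i, ContinuousLinearMap.smulRightL ℝ V W (LinearMap.toContinuousLinearMap (b.coord i))
        (fderiv ℝ (G τ) q (b i)) := by
    intro τ
    ext v
    conv_lhs => rw [← b.sum_repr v, map_sum]
    simp
  rw [funext h2]
  refine Finset.aestronglyMeasurable_fun_sum _ fun i _ => ?_
  exact (ContinuousLinearMap.continuous _).comp_aestronglyMeasurable (h1 (b i))

lemma aux_meas_iter {V : Type*} [NormedAddCommGroup V] [NormedSpace ℝ V] [FiniteDimensional ℝ V]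
    {μ : Measure ℝ} (G : ℝ → V → ℝ) (k : ℕ)
    (hd : ∀ᵐ τ ∂μ, ContDiff ℝ k (G τ))
    (hm : ∀ q, AEStronglyMeasurable (fun τ => G τ q) μ) (i : ℕ) (hi : i ≤ k) (q : V) :
    AEStronglyMeasurable (fun τ => iteratedFDeriv ℝ i (G τ) q) μ := by
  induction i generalizing q with
  | zero =>
    simp_rw [iteratedFDeriv_zero_eq_comp]
    exact (LinearIsometryEquiv.continuous _).comp_aestronglyMeasurable (hm q)
  | succ i ih =>
    simp_rw [iteratedFDeriv_succ_eq_comp_left]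
    refine (LinearIsometryEquiv.continuous _).comp_aestronglyMeasurable ?_
    refine aux_meas_fderiv (fun τ => iteratedFDeriv ℝ i (G τ)) ?_ (fun q => ih (by omega) q) q
    filter_upwards [hd] with τ hτ
    exact hτ.differentiable_iteratedFDeriv (by exact_mod_cast hi)

lemma aux_smooth {V : Type*} [NormedAddCommGroup V] [NormedSpace ℝ V] [FiniteDimensional ℝ V]
    {μ : Measure ℝ} (G : ℝ → V → ℝ) (k : ℕ) (b : ℝ → ℝ) (hb : Integrable b μ)
    (hd : ∀ᵐ τ ∂μ, ContDiff ℝ k (G τ))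
    (hbd : ∀ᵐ τ ∂μ, ∀ i ≤ k, ∀ q, ‖iteratedFDeriv ℝ i (G τ) q‖ ≤ b τ)
    (hm : ∀ q, AEStronglyMeasurable (fun τ => G τ q) μ) :
    ContDiff ℝ k (fun q => ∫ τ, G τ q ∂μ) ∧
    ∀ i ≤ k, ∀ q, Integrable (fun τ => iteratedFDeriv ℝ i (G τ) q) μ ∧
      iteratedFDeriv ℝ i (fun q => ∫ τ, G τ q ∂μ) q = ∫ τ, iteratedFDeriv ℝ i (G τ) q ∂μ := by
  have hmi := aux_meas_iter G k hd hm
  have hint : ∀ i ≤ k, ∀ q, Integrable (fun τ => iteratedFDeriv ℝ i (G τ) q) μ := by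
    intro i hi q
    refine hb.mono' (hmi i hi q) ?_
    filter_upwards [hbd] with τ hτ using hτ i hi q
  have hT : HasFTaylorSeriesUpTo k (fun q => ∫ τ, G τ q ∂μ)
      (fun q i => ∫ τ, iteratedFDeriv ℝ i (G τ) q ∂μ) := by
    refine ⟨?_, ?_, ?_⟩
    · intro q
      rw [ContinuousMultilinearMap.curry0, ContinuousMultilinearMap.integral_apply (hint 0 (by omega) q)]
      simp
    · intro m hm' q
      have hmk : m + 1 ≤ k := by
        have : m < k := by exact_mod_cast hm'
        omega
      have key := hasFDerivAt_integral_of_dominated_of_fderiv_le (μ := μ) (𝕜 := ℝ)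
        (F := fun q τ => iteratedFDeriv ℝ m (G τ) q) (x₀ := q) (s := univ) (bound := b)
        (F' := fun q τ => (iteratedFDeriv ℝ (m+1) (G τ) q).curryLeft) univ_mem
        (Eventually.of_forall fun q => hmi m (by omega) q) (hint m (by omega) q)
        ((continuousMultilinearCurryLeftEquiv ℝ (fun _ : Fin (m+1) => V) ℝ).continuous.comp_aestronglyMeasurable
          (hmi (m+1) hmk q)) ?_ hb ?_
      · refine key.congr_fderiv ?_
        exact (ContinuousLinearEquiv.integral_comp_comm (𝕜 := ℝ) (μ := μ)
          (E := ContinuousMultilinearMap ℝ (fun _ : Fin (m+1) => V) ℝ)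
          (F := V →L[ℝ] ContinuousMultilinearMap ℝ (fun _ : Fin m => V) ℝ)
          (continuousMultilinearCurryLeftEquiv ℝ (fun _ : Fin (m+1) => V) ℝ).toContinuousLinearEquiv
          (fun τ => iteratedFDeriv ℝ (m+1) (G τ) q))
      · filter_upwards [hbd] with τ hτ x _
        rw [ContinuousMultilinearMap.curryLeft_norm]
        exact hτ _ hmk x
      · filter_upwards [hd] with τ hτ x _
        exact (contDiff_iff_ftaylorSeries.1 hτ).fderiv m hm' x
    · intro m hm'
      have hmk : m ≤ k := by exact_mod_cast hm'
      refine continuous_of_dominated (bound := b) (fun q => hmi m hmk q) (fun q => ?_) hb ?_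
      · filter_upwards [hbd] with τ hτ using hτ m hmk q
      · filter_upwards [hd] with τ hτ using hτ.continuous_iteratedFDeriv hm'
  exact ⟨hT.contDiff, fun i hi q => ⟨hint i hi q,
    (hT.eq_iteratedFDeriv (by exact_mod_cast hi) q).symm⟩⟩

lemma aux_shift {W : Type*} [NormedAddCommGroup W] [NormedSpace ℝ W] (h : ℝ → W) (t : ℝ) :
    ∫ τ in Ici t, h τ = ∫ u in Ici (0:ℝ), h (t + u) := by
  have := (measurePreserving_add_left (volume : Measure ℝ) t).setIntegral_preimage_emb
    (measurableEmbedding_addLeft t) h (Ici t)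
  rw [← this]
  simp

lemma aux_integrable (a t : ℝ) (ha : 1 < a) (ht : 0 ≤ t) :
    IntegrableOn (fun u : ℝ => (1 + (t + u)) ^ (-a)) (Ici 0) := by
  have h := integrableOn_add_rpow_Ioi_of_lt (a := -a) (c := 0) (m := 1 + t) (by linarith) (by linarith)
  rw [integrableOn_Ici_iff_integrableOn_Ioi]
  refine h.congr_fun (fun u _ => ?_) measurableSet_Ioi
  simp only
  congr 1
  ring

lemma aux_integral (a t : ℝ) (ha : 1 < a) (ht : 0 ≤ t) :
    ∫ u in Ici (0:ℝ), (1 + (t + u)) ^ (-a) = (1 + t) ^ (1 - a) / (a - 1) := by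
  have h := integral_Ioi_rpow_of_lt (a := -a) (by linarith) (c := 1 + t) (by linarith)
  rw [← integral_Ici_eq_integral_Ioi, aux_shift] at h
  simp_rw [← add_assoc]
  rw [h, show -a + 1 = -(a - 1) by ring, neg_div_neg_eq, show 1 - a = -(a-1) by ring]

lemma aux_w (a t : ℝ) (ha : 0 < a) (ht : 0 ≤ t) : 1 + t ^ a ≤ 2 * (1 + t) ^ a := by
  have h1 : (1:ℝ) ≤ (1 + t) ^ a := Real.one_le_rpow (by linarith) ha.le
  have h2 : t ^ a ≤ (1 + t) ^ a := Real.rpow_le_rpow ht (by linarith) ha.le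
  linarith

lemma aux_w' (a t : ℝ) (ha : 0 < a) (ht : 0 ≤ t) : 1 / (1 + t ^ a) ≤ 2 ^ a * (1 + t) ^ (-a) := by
  have h0 : 0 ≤ t ^ a := Real.rpow_nonneg ht a
  have h1 : (1 + t) ^ a ≤ 2 ^ a * (1 + t ^ a) := by
    rcases le_total t 1 with h | h
    · calc (1 + t) ^ a ≤ 2 ^ a := Real.rpow_le_rpow (by linarith) (by linarith) ha.le
        _ ≤ _ := le_mul_of_one_le_right (by positivity) (by linarith)
    · calc (1 + t) ^ a ≤ (2 * t) ^ a := Real.rpow_le_rpow (by linarith) (by linarith) ha.le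
        _ = 2 ^ a * t ^ a := Real.mul_rpow (by norm_num) ht
        _ ≤ _ := mul_le_mul_of_nonneg_left (by linarith) (by positivity)
  rw [Real.rpow_neg (by linarith), ← div_eq_mul_inv, div_le_div_iff₀ (by linarith) (by positivity)]
  linarith

lemma aux_J (a t : ℝ) (ha : 1 < a) (ht : 0 ≤ t) :
    (∫ u in Ici (0:ℝ), (1 + (t + u)) ^ (-a)) * (1 + t ^ (a - 1)) ≤ 2 / (a - 1) := by
  rw [aux_integral a t ha ht]
  have h := aux_w (a - 1) t (by linarith) ht
  have hp : 0 < (1 + t) ^ (a - 1) := by positivity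
  have ha' : 0 < a - 1 := by linarith
  rw [show 1 - a = -(a-1) by ring, Real.rpow_neg (by linarith), div_mul_eq_mul_div]
  gcongr
  rw [inv_mul_le_iff₀ hp]
  linarith

lemma aux_iSup {α : Type*} {s : Set α} {f : α → ℝ≥0∞} {B : ℝ≥0∞} (h : ⨆ x ∈ s, f x ≤ B) {x : α} (hx : x ∈ s) :
    f x ≤ B := (le_iSup₂ (f := fun x (_ : x ∈ s) => f x) x hx).trans h

end Aux

section Aux2

lemma holder_elim {σ : ℝ} {f : E n → ℝ} {B : ℝ} (hB : 0 ≤ B)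
    (h : holderNormOn σ univ f ≤ ENNReal.ofReal B) :
    (∀ i ≤ ⌊σ⌋₊, ∀ x, ‖iteratedFDeriv ℝ i f x‖ ≤ B) ∧
    ((⌊σ⌋₊ : ℝ) ≠ σ → ∀ x y, ‖iteratedFDeriv ℝ ⌊σ⌋₊ f x - iteratedFDeriv ℝ ⌊σ⌋₊ f y‖
      ≤ B * ‖x - y‖ ^ (σ - (⌊σ⌋₊ : ℝ))) := by
  unfold holderNormOn at h
  constructor
  · intro i hi x
    have h1 := le_self_add.trans h
    unfold cNormOn at h1
    have h2 := aux_iSup ((le_iSup _ (⟨i, by omega⟩ : Fin (⌊σ⌋₊ + 1))).trans h1) (mem_univ x)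
    simp only [iteratedFDerivWithin_univ] at h2
    rw [← enorm_eq_nnnorm, ← ofReal_norm] at h2
    exact (ENNReal.ofReal_le_ofReal_iff hB).1 h2
  · intro hσ x y
    have h1 := le_add_self.trans h
    rw [if_neg hσ] at h1
    rcases eq_or_ne x y with rfl | hxy
    · simp only [sub_self, norm_zero]
      positivity
    have h2 := (le_iSup _ hxy).trans (aux_iSup (aux_iSup h1 (mem_univ x)) (mem_univ y))
    simp only [iteratedFDerivWithin_univ] at h2
    have h3 := (ENNReal.ofReal_le_ofReal_iff hB).1 h2
    have : 0 < ‖x - y‖ := norm_pos_iff.2 (sub_ne_zero.2 hxy)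
    rwa [div_le_iff₀ (by positivity)] at h3

lemma holder_intro {σ : ℝ} {f : E n → ℝ} {B : ℝ} (hB : 0 ≤ B)
    (h1 : ∀ i ≤ ⌊σ⌋₊, ∀ x, ‖iteratedFDeriv ℝ i f x‖ ≤ B)
    (h2 : (⌊σ⌋₊ : ℝ) ≠ σ → ∀ x y, ‖iteratedFDeriv ℝ ⌊σ⌋₊ f x - iteratedFDeriv ℝ ⌊σ⌋₊ f y‖
      ≤ B * ‖x - y‖ ^ (σ - (⌊σ⌋₊ : ℝ))) :
    holderNormOn σ univ f ≤ ENNReal.ofReal (2 * B) := by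
  unfold holderNormOn cNormOn
  rw [two_mul, ENNReal.ofReal_add hB hB]
  gcongr
  · refine iSup_le fun i => iSup₂_le fun x _ => ?_
    rw [iteratedFDerivWithin_univ, ← enorm_eq_nnnorm, ← ofReal_norm]
    exact ENNReal.ofReal_le_ofReal (h1 i (by omega) x)
  · split_ifs with hσ
    · exact zero_le
    · refine iSup₂_le fun x _ => iSup₂_le fun y _ => iSup_le fun hxy => ?_
      rw [iteratedFDerivWithin_univ]
      have : 0 < ‖x - y‖ := norm_pos_iff.2 (sub_ne_zero.2 hxy)
      refine ENNReal.ofReal_le_ofReal ?_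
      rw [div_le_iff₀ (by positivity)]
      exact h2 hσ x y

variable {l K A σ : ℝ} {D' : Set (E n)} {ω : E n → E n} {g κ : E n → E n → ℝ → ℝ}

lemma g_bound (hA : 0 ≤ A)
    (hM1 : ∀ p ∈ D', ∀ t ∈ Ici (0:ℝ), holderNormOn σ univ (fun q => g q p t) ≤
      ENNReal.ofReal (A * (1 + t) ^ (-(l+1)))) (q : E n) {p : E n} (hp : p ∈ D') {t : ℝ} (ht : 0 ≤ t) :
    ‖g q p t‖ ≤ A * (1 + t) ^ (-(l+1)) := by
  have := (holder_elim (by positivity) (hM1 p hp t ht)).1 0 (by omega) q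
  rwa [norm_iteratedFDeriv_zero] at this

lemma g_lip (hA : 0 ≤ A) (hσ : 1 ≤ σ) (hg : MemDp σ D' g)
    (hM1 : ∀ p ∈ D', ∀ t ∈ Ici (0:ℝ), holderNormOn σ univ (fun q => g q p t) ≤
      ENNReal.ofReal (A * (1 + t) ^ (-(l+1)))) (q q' : E n) {p : E n} (hp : p ∈ D') {t : ℝ} (ht : 0 ≤ t) :
    ‖g q p t - g q' p t‖ ≤ A * (1 + t) ^ (-(l+1)) * ‖q - q'‖ := by
  have h1 : 1 ≤ ⌊σ⌋₊ := by
    rw [Nat.one_le_floor_iff]; exact hσ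
  have hd := (contDiffOn_univ.1 (hg.2.2 p hp t ht).1).differentiable (by
    have : ⌊σ⌋₊ ≠ 0 := by omega
    exact_mod_cast this)
  refine Convex.norm_image_sub_le_of_norm_fderiv_le (𝕜 := ℝ) (f := fun q => g q p t) (s := univ)
    (fun x _ => hd x) (fun x _ => ?_) convex_univ (mem_univ _) (mem_univ _)
  rw [← norm_iteratedFDeriv_one]
  exact (holder_elim (by positivity) (hM1 p hp t ht)).1 1 h1 x

lemma g_cont (hg : MemDp σ D' g) (hω : ContinuousOn ω D') {u : ℝ} (hu : 0 ≤ u) :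
    ContinuousOn (fun x : E n × E n × ℝ => g (x.1 + u • ω x.2.1) x.2.1 (x.2.2 + u))
      (univ ×ˢ (D' ×ˢ Ici 0)) := by
  have h := hg.1
  refine h.comp (f := fun x : E n × E n × ℝ => (x.1 + u • ω x.2.1, x.2.1, x.2.2 + u)) ?_ ?_
  · have : ContinuousOn (fun x : E n × E n × ℝ => ω x.2.1) (univ ×ˢ (D' ×ˢ Ici 0)) :=
      hω.comp (by fun_prop) (fun x hx => hx.2.1)
    exact ContinuousOn.prodMk (ContinuousOn.add (by fun_prop) (this.const_smul u))
      (by fun_prop)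
  · rintro ⟨a, b, c⟩ ⟨-, hb, hc⟩
    have hc' : 0 ≤ c := hc
    exact ⟨mem_univ _, hb, by simp only [mem_Ici]; linarith⟩

lemma g_cont' (hg : MemDp σ D' g) (θ w : E n) {p : E n} (hp : p ∈ D') {t : ℝ} (ht : 0 ≤ t) :
    ContinuousOn (fun u : ℝ => g (θ + u • w) p (t + u)) (Ici 0) := by
  have h := hg.1
  refine h.comp (f := fun u : ℝ => (θ + u • w, p, t + u)) (by fun_prop) ?_
  intro u hu
  have hu' : 0 ≤ u := hu
  exact ⟨mem_univ _, hp, by simp only [mem_Ici]; linarith⟩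

lemma g_meas (hg : MemDp σ D' g) (θ w : E n) {p : E n} (hp : p ∈ D') {t : ℝ} (ht : 0 ≤ t) :
    AEStronglyMeasurable (fun u : ℝ => g (θ + u • w) p (t + u)) (volume.restrict (Ici 0)) :=
  (g_cont' hg θ w hp ht).aestronglyMeasurable measurableSet_Ici

lemma g_int (hl : 1 < l) (hA : 0 ≤ A) (hg : MemDp σ D' g)
    (hM1 : ∀ p ∈ D', ∀ t ∈ Ici (0:ℝ), holderNormOn σ univ (fun q => g q p t) ≤
      ENNReal.ofReal (A * (1 + t) ^ (-(l+1)))) (θ w : E n) {p : E n} (hp : p ∈ D') {t : ℝ} (ht : 0 ≤ t) :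
    IntegrableOn (fun u : ℝ => g (θ + u • w) p (t + u)) (Ici 0) := by
  refine ((aux_integrable (l+1) t (by linarith) ht).const_mul A).mono' (g_meas hg θ w hp ht) ?_
  filter_upwards [self_mem_ae_restrict measurableSet_Ici] with u hu
  exact g_bound hA hM1 _ hp (add_nonneg ht hu)

lemma kap_cont (hl : 1 < l) (hA : 0 ≤ A) (hg : MemDp σ D' g) (hω : ContinuousOn ω D')
    (hM1 : ∀ p ∈ D', ∀ t ∈ Ici (0:ℝ), holderNormOn σ univ (fun q => g q p t) ≤
      ENNReal.ofReal (A * (1 + t) ^ (-(l+1))))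
    (hκ : ∀ θ p t, κ θ p t = -∫ u in Ici (0:ℝ), g (θ + u • ω p) p (t + u)) :
    ContinuousOn (fun x : E n × E n × ℝ => κ x.1 x.2.1 x.2.2) (univ ×ˢ (D' ×ˢ Ici 0)) := by
  simp_rw [hκ]
  refine ContinuousOn.neg ?_
  refine continuousOn_of_dominated (bound := fun u => A * (1 + (0 + u)) ^ (-(l+1)))
    (fun x hx => g_meas hg _ _ hx.2.1 hx.2.2) (fun x hx => ?_)
    ((aux_integrable (l+1) 0 (by linarith) le_rfl).const_mul A) ?_
  · filter_upwards [self_mem_ae_restrict measurableSet_Ici] with u hu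
    have hu' : 0 ≤ u := hu
    have hx' : 0 ≤ x.2.2 := hx.2.2
    refine (g_bound hA hM1 _ hx.2.1 (add_nonneg hx.2.2 hu)).trans ?_
    refine mul_le_mul_of_nonneg_left ?_ hA
    exact Real.rpow_le_rpow_of_nonpos (by linarith) (by linarith) (by linarith)
  · filter_upwards [self_mem_ae_restrict measurableSet_Ici] with u hu
    exact g_cont hg hω hu

lemma kap_holder (hl : 1 < l) (hA : 0 ≤ A) (hg : MemDp σ D' g)
    (hM1 : ∀ p ∈ D', ∀ t ∈ Ici (0:ℝ), holderNormOn σ univ (fun q => g q p t) ≤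
      ENNReal.ofReal (A * (1 + t) ^ (-(l+1))))
    (hκ : ∀ θ p t, κ θ p t = -∫ u in Ici (0:ℝ), g (θ + u • ω p) p (t + u))
    {p : E n} (hp : p ∈ D') {t : ℝ} (ht : 0 ≤ t) :
    ContDiff ℝ ⌊σ⌋₊ (fun q => κ q p t) ∧ holderNormOn σ univ (fun q => κ q p t) ≤
      ENNReal.ofReal (2 * (A * ∫ u in Ici (0:ℝ), (1 + (t + u)) ^ (-(l+1)))) := by
  have hb : IntegrableOn (fun u => A * (1 + (t + u)) ^ (-(l+1))) (Ici 0) :=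
    (aux_integrable (l+1) t (by linarith) ht).const_mul A
  have hel : ∀ u ∈ Ici (0:ℝ), _ := fun u hu =>
    holder_elim (mul_nonneg hA (Real.rpow_nonneg (by linarith [mem_Ici.1 hu]) _))
      (hM1 p hp (t + u) (add_nonneg ht hu))
  have hsm : ∀ᵐ u ∂(volume.restrict (Ici (0:ℝ))),
      ContDiff ℝ ⌊σ⌋₊ (fun q => g (q + u • ω p) p (t + u)) := by
    filter_upwards [self_mem_ae_restrict measurableSet_Ici] with u hu
    exact (contDiffOn_univ.1 (hg.2.2 p hp (t+u) (add_nonneg ht hu)).1).comp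
      (contDiff_id.add contDiff_const)
  have hbd : ∀ᵐ u ∂(volume.restrict (Ici (0:ℝ))), ∀ i ≤ ⌊σ⌋₊, ∀ q,
      ‖iteratedFDeriv ℝ i (fun q => g (q + u • ω p) p (t + u)) q‖ ≤
        A * (1 + (t + u)) ^ (-(l+1)) := by
    filter_upwards [self_mem_ae_restrict measurableSet_Ici] with u hu i hi q
    rw [iteratedFDeriv_comp_add_right (f := fun q => g q p (t + u))]
    exact (hel u hu).1 i hi _
  obtain ⟨h1, h2⟩ := aux_smooth (μ := volume.restrict (Ici 0))
    (fun u q => g (q + u • ω p) p (t + u)) ⌊σ⌋₊ _ hb hsm hbd (fun q => g_meas hg _ _ hp ht)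
  have hκ' : (fun q => κ q p t) = -fun q => ∫ u in Ici (0:ℝ), g (q + u • ω p) p (t + u) := by
    funext q
    exact hκ q p t
  rw [hκ', ← integral_const_mul]
  refine ⟨h1.neg, holder_intro ?_ ?_ ?_⟩
  · refine setIntegral_nonneg measurableSet_Ici fun u hu => ?_
    exact mul_nonneg hA (Real.rpow_nonneg (by linarith [mem_Ici.1 hu]) _)
  · intro i hi x
    rw [iteratedFDeriv_neg_apply, norm_neg, (h2 i hi x).2]
    refine norm_integral_le_of_norm_le hb ?_
    filter_upwards [self_mem_ae_restrict measurableSet_Ici] with u hu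
    rw [iteratedFDeriv_comp_add_right (f := fun q => g q p (t + u))]
    exact (hel u hu).1 i hi _
  · intro hσ x y
    rw [iteratedFDeriv_neg_apply, iteratedFDeriv_neg_apply, ← neg_sub', norm_neg,
      (h2 _ le_rfl x).2, (h2 _ le_rfl y).2, ← integral_sub (h2 _ le_rfl x).1 (h2 _ le_rfl y).1,
      ← integral_mul_const]
    refine norm_integral_le_of_norm_le (hb.mul_const _) ?_
    filter_upwards [self_mem_ae_restrict measurableSet_Ici] with u hu
    rw [iteratedFDeriv_comp_add_right (f := fun q => g q p (t + u)),
      iteratedFDeriv_comp_add_right (f := fun q => g q p (t + u))]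
    have := (hel u hu).2 hσ (x + u • ω p) (y + u • ω p)
    rwa [add_sub_add_right_eq_sub] at this

lemma kap_bound (hl : 1 < l) (hA : 0 ≤ A)
    (hM1 : ∀ p ∈ D', ∀ t ∈ Ici (0:ℝ), holderNormOn σ univ (fun q => g q p t) ≤
      ENNReal.ofReal (A * (1 + t) ^ (-(l+1))))
    (hκ : ∀ θ p t, κ θ p t = -∫ u in Ici (0:ℝ), g (θ + u • ω p) p (t + u))
    (q : E n) {p : E n} (hp : p ∈ D') {t : ℝ} (ht : 0 ≤ t) :
    ‖κ q p t‖ ≤ A * ∫ u in Ici (0:ℝ), (1 + (t + u)) ^ (-l) := by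
  rw [hκ, norm_neg, ← integral_const_mul]
  refine norm_integral_le_of_norm_le ((aux_integrable l t (by linarith) ht).const_mul A) ?_
  filter_upwards [self_mem_ae_restrict measurableSet_Ici] with u hu
  refine (g_bound hA hM1 _ hp (add_nonneg ht hu)).trans ?_
  refine mul_le_mul_of_nonneg_left ?_ hA
  exact Real.rpow_le_rpow_of_exponent_le (by linarith [mem_Ici.1 hu]) (by linarith)

lemma kap_lip (hl : 1 < l) (hA : 0 ≤ A) (hσ : 1 ≤ σ) (hg : MemDp σ D' g)
    (hM1 : ∀ p ∈ D', ∀ t ∈ Ici (0:ℝ), holderNormOn σ univ (fun q => g q p t) ≤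
      ENNReal.ofReal (A * (1 + t) ^ (-(l+1))))
    (hM2 : ∀ q, ∀ x ∈ D', ∀ y ∈ D', ∀ t ∈ Ici (0:ℝ), ‖g q x t - g q y t‖ ≤
      A * (1 + t) ^ (-l) * ‖x - y‖)
    (hωL : ∀ x ∈ D', ∀ y ∈ D', ‖ω x - ω y‖ ≤ K * ‖x - y‖)
    (hκ : ∀ θ p t, κ θ p t = -∫ u in Ici (0:ℝ), g (θ + u • ω p) p (t + u))
    (q : E n) {x y : E n} (hx : x ∈ D') (hy : y ∈ D') {t : ℝ} (ht : 0 ≤ t) :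
    ‖κ q x t - κ q y t‖ ≤ A * (K + 1) * (∫ u in Ici (0:ℝ), (1 + (t + u)) ^ (-l)) * ‖x - y‖ := by
  rw [hκ, hκ, ← neg_sub', norm_neg, ← integral_sub (g_int hl hA hg hM1 _ _ hx ht)
    (g_int hl hA hg hM1 _ _ hy ht), ← integral_const_mul, ← integral_mul_const]
  refine norm_integral_le_of_norm_le
    (((aux_integrable l t (by linarith) ht).const_mul _).mul_const _) ?_
  filter_upwards [self_mem_ae_restrict measurableSet_Ici] with u hu
  have hu' : 0 ≤ u := hu
  have hp : 0 < (1 + (t + u)) := by linarith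
  have e1 := g_lip hA hσ hg hM1 (q + u • ω x) (q + u • ω y) hx (add_nonneg ht hu)
  have e2 := hM2 (q + u • ω y) x hx y hy (t + u) (add_nonneg ht hu)
  have e3 : ‖q + u • ω x - (q + u • ω y)‖ ≤ (1 + (t + u)) * (K * ‖x - y‖) := by
    rw [add_sub_add_left_eq_sub, ← smul_sub, norm_smul, Real.norm_of_nonneg hu']
    exact mul_le_mul (by linarith) (hωL x hx y hy) (norm_nonneg _) hp.le
  have e4 : (1 + (t + u)) ^ (-(l+1)) * (1 + (t + u)) = (1 + (t + u)) ^ (-l) := by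
    rw [← Real.rpow_add_one hp.ne']
    congr 1
    ring
  calc _ ≤ ‖g (q + u • ω x) x (t + u) - g (q + u • ω y) x (t + u)‖ +
      ‖g (q + u • ω y) x (t + u) - g (q + u • ω y) y (t + u)‖ := norm_sub_le_norm_sub_add_norm_sub _ _ _
    _ ≤ A * (1 + (t + u)) ^ (-(l+1)) * ((1 + (t + u)) * (K * ‖x - y‖)) +
        A * (1 + (t + u)) ^ (-l) * ‖x - y‖ :=
      add_le_add (e1.trans (mul_le_mul_of_nonneg_left e3 (by positivity))) e2
    _ = _ := by
      rw [← e4]; ring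

lemma kap_deriv (hl : 1 < l) (hA : 0 ≤ A) (hg : MemDp σ D' g)
    (hM1 : ∀ p ∈ D', ∀ t ∈ Ici (0:ℝ), holderNormOn σ univ (fun q => g q p t) ≤
      ENNReal.ofReal (A * (1 + t) ^ (-(l+1))))
    (hκ : ∀ θ p t, κ θ p t = -∫ τ in Ici t, g (θ + (τ - t) • ω p) p τ)
    (θ : E n) {p : E n} (hp : p ∈ D') {t : ℝ} (ht : 0 ≤ t) :
    HasDerivWithinAt (fun s : ℝ => κ (θ + s • ω p) p (t + s)) (g θ p t) (Ici (-t)) 0 := by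
  set h : ℝ → ℝ := fun τ => g (θ + (τ - t) • ω p) p τ with hh
  have hh' : h = fun τ => g ((θ - t • ω p) + τ • ω p) p (0 + τ) := by
    funext τ
    simp only [hh, zero_add]
    congr 1
    rw [sub_smul]; abel
  have hcont : ContinuousOn h (Ici 0) := by
    rw [hh']; exact g_cont' hg _ _ hp le_rfl
  have hint : IntegrableOn h (Ici 0) := by
    rw [hh']; exact g_int hl hA hg hM1 _ _ hp le_rfl
  set H : ℝ → ℝ := fun τ => h (max τ 0) with hH
  have hHc : Continuous H := by
    rw [← continuousOn_univ]
    exact hcont.comp (by fun_prop) (fun x _ => mem_Ici.2 (le_max_right _ _))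
  have hHh : EqOn H h (Ici 0) := fun τ hτ => by simp [hH, max_eq_left (mem_Ici.1 hτ)]
  have e : ∀ s ∈ Ici (-t), κ (θ + s • ω p) p (t + s) =
      (∫ τ in (0:ℝ)..(t + s), H τ) - ∫ τ in Ici (0:ℝ), h τ := by
    intro s hs
    have hs' : 0 ≤ t + s := by linarith [mem_Ici.1 hs]
    have e1 : κ (θ + s • ω p) p (t + s) = -∫ τ in Ici (t + s), h τ := by
      rw [hκ]
      congr 2
      funext τ
      simp only [hh]
      congr 1
      rw [add_assoc, ← add_smul]
      congr 2
      ring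
    have e2 : ∫ τ in (0:ℝ)..(t + s), H τ = ∫ τ in (0:ℝ)..(t + s), h τ := by
      refine intervalIntegral.integral_congr fun τ hτ => hHh ?_
      rw [uIcc_of_le hs'] at hτ
      exact hτ.1
    rw [e1, e2, integral_Ici_eq_integral_Ioi, integral_Ici_eq_integral_Ioi,
      ← intervalIntegral.integral_Ioi_sub_Ioi (hint.mono_set Ioi_subset_Ici_self) hs']
    ring
  have hd : HasDerivAt (fun s : ℝ => (∫ τ in (0:ℝ)..(t + s), H τ) - ∫ τ in Ici (0:ℝ), h τ) (H (t+0)) 0 := by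
    refine HasDerivAt.sub_const _ ?_
    exact HasDerivAt.comp_const_add t 0 (hHc.integral_hasStrictDerivAt 0 (t + 0)).hasDerivAt
  have hval : H (t + 0) = g θ p t := by
    rw [add_zero, hHh ht]
    simp [hh]
  rw [← hval]
  exact hd.hasDerivWithinAt.congr e (e 0 (by simpa using ht))

lemma uniq_aux (d : E n → ℝ → ℝ) (w : E n)
    (hd : ∀ θ : E n, ∀ t ∈ Ici (0:ℝ),
      HasDerivWithinAt (fun s : ℝ => d (θ + s • w) (t + s)) 0 (Ici (-t)) 0)
    (hlim : ∀ θ : E n, ∀ t ∈ Ici (0:ℝ), Tendsto (fun s : ℝ => d (θ + s • w) (t + s)) atTop (𝓝 0))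
    (θ : E n) (t : ℝ) (ht : 0 ≤ t) : d θ t = 0 := by
  set φ : ℝ → ℝ := fun s => d (θ + s • w) (t + s) with hφ
  have h1 : ∀ s ∈ Ici (0:ℝ), HasDerivWithinAt φ 0 (Ici 0) s := by
    intro s hs
    have hs' : 0 ≤ s := hs
    have h := hd (θ + s • w) (t + s) (add_nonneg ht hs)
    have h' : HasDerivWithinAt (fun r : ℝ => d (θ + s • w + r • w) (t + s + r)) 0 (Ici (-(t+s))) (s - s) := by
      rwa [sub_self]
    have h2 := HasDerivWithinAt.scomp (𝕜 := ℝ) (g₁ := fun r : ℝ => d (θ + s • w + r • w) (t + s + r))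
      (h := fun r => r - s) (h' := 1) (s := Ici (0:ℝ)) s h' ((hasDerivWithinAt_id s _).sub_const s) (by
        intro r hr
        have hr' : 0 ≤ r := hr
        simp only [mem_Ici]
        linarith)
    rw [smul_zero] at h2
    refine h2.congr_of_eventuallyEq_of_mem (Eventually.of_forall fun r => ?_) hs
    simp only [hφ, Function.comp]
    congr 1
    · rw [add_assoc, ← add_smul]; congr 2; ring
    · ring
  have h2 : ∀ s ∈ Ici (0:ℝ), φ s = φ 0 := by
    intro s hs
    refine (convex_Ici 0).is_const_of_fderivWithin_eq_zero (𝕜 := ℝ)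
      (fun x hx => (h1 x hx).differentiableWithinAt) (fun x hx => ?_) hs (mem_Ici.2 le_rfl)
    have := (h1 x hx).hasFDerivWithinAt.fderivWithin ((uniqueDiffOn_Ici 0) x hx)
    rw [this]
    ext; simp
  have h3 : Tendsto φ atTop (𝓝 (φ 0)) :=
    tendsto_const_nhds.congr' (by
      filter_upwards [eventually_ge_atTop 0] with s hs using (h2 s hs).symm)
  have h4 := tendsto_nhds_unique h3 (hlim θ t ht)
  simpa [hφ] using h4

end Aux2

/-- **Homological equation (Lipschitz version): existence, uniqueness and estimate.** -/
theorem homological_equation_lipschitz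
    (n : ℕ) (l K : ℝ) (hl : 1 < l) (hK : 0 ≤ K) :
    ∃ C : ℝ, 0 < C ∧
    ∀ (σ : ℝ) (D' : Set (E n)) (ω : E n → E n) (g κ : E n → E n → ℝ → ℝ),
      1 ≤ σ →
      IsClosed D' →
      ContinuousOn ω D' →
      lipNormOn D' ω ≤ ENNReal.ofReal K →
      MemDp σ D' g →
      wnormDp σ (l + 1) D' g < ⊤ →
      (∀ (θ p₀ : E n) (t : ℝ), κ θ p₀ t = -∫ τ in Ici t, g (θ + (τ - t) • ω p₀) p₀ τ) →
      -- κ belongs to D⁺_σ and solves the homological equation with decaying C⁰ norm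
      MemDp σ D' κ ∧
      (∀ θ : E n, ∀ p₀ ∈ D', ∀ t ∈ Ici (0:ℝ),
        HasDerivWithinAt (fun s : ℝ => κ (θ + s • ω p₀) p₀ (t + s)) (g θ p₀ t) (Ici (-t)) 0) ∧
      (∀ p₀ ∈ D',
        Tendsto (fun t : ℝ => ⨆ θ : E n, (‖κ θ p₀ t‖₊ : ℝ≥0∞)) atTop (𝓝 0)) ∧
      -- uniqueness
      (∀ κ' : E n → E n → ℝ → ℝ,
        MemDp σ D' κ' →
        (∀ θ : E n, ∀ p₀ ∈ D', ∀ t ∈ Ici (0:ℝ),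
          HasDerivWithinAt (fun s : ℝ => κ' (θ + s • ω p₀) p₀ (t + s)) (g θ p₀ t) (Ici (-t)) 0) →
        (∀ p₀ ∈ D',
          Tendsto (fun t : ℝ => ⨆ θ : E n, (‖κ' θ p₀ t‖₊ : ℝ≥0∞)) atTop (𝓝 0)) →
        ∀ θ : E n, ∀ p₀ ∈ D', ∀ t ∈ Ici (0:ℝ), κ' θ p₀ t = κ θ p₀ t) ∧
      -- estimate
      wnormDp σ l D' κ ≤ ENNReal.ofReal C * wnormDp σ (l + 1) D' g := by
  have hl0 : 0 < l := by linarith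
  have hl1 : 0 < l - 1 := by linarith
  refine ⟨2 ^ (l+1) * (4 / l + (K + 2) * (2 / (l - 1))), by positivity, ?_⟩
  intro σ D' ω g κ hσ _ hω hωK hg hgM hκ
  set M : ℝ := (wnormDp σ (l + 1) D' g).toReal with hM
  have hM0 : 0 ≤ M := ENNReal.toReal_nonneg
  have hMe : wnormDp σ (l + 1) D' g = ENNReal.ofReal M := (ENNReal.ofReal_toReal hgM.ne).symm
  set A : ℝ := M * 2 ^ (l+1) with hAdef
  have hA : 0 ≤ A := by positivity
  have hM1 : ∀ p ∈ D', ∀ t ∈ Ici (0:ℝ), holderNormOn σ univ (fun q => g q p t) ≤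
      ENNReal.ofReal (A * (1 + t) ^ (-(l+1))) := by
    intro p hp t ht
    have ht' : 0 ≤ t := ht
    have h0 := hMe.le
    unfold wnormDp at h0
    have h1 := aux_iSup (aux_iSup (le_self_add.trans h0) hp) ht
    have hw : w1 (l+1) t = 1 + t ^ (l+1) := by
      rw [w1, if_neg (by linarith), abs_of_nonneg ht']
    have hwp : 0 < 1 + t ^ (l+1) := by positivity
    rw [hw, ← ENNReal.le_div_iff_mul_le (Or.inl (by simpa using hwp)) (Or.inl ENNReal.ofReal_ne_top),
      ← ENNReal.ofReal_div_of_pos hwp] at h1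
    refine h1.trans (ENNReal.ofReal_le_ofReal ?_)
    have := aux_w' (l+1) t (by linarith) ht'
    rw [hAdef, mul_assoc, div_eq_mul_one_div]
    exact mul_le_mul_of_nonneg_left this hM0
  have hM2 : ∀ q, ∀ x ∈ D', ∀ y ∈ D', ∀ t ∈ Ici (0:ℝ), ‖g q x t - g q y t‖ ≤
      A * (1 + t) ^ (-l) * ‖x - y‖ := by
    intro q x hx y hy t ht
    have ht' : 0 ≤ t := ht
    rcases eq_or_ne x y with rfl | hxy
    · simp
    have h0 := hMe.le
    unfold wnormDp at h0
    have h1 := aux_iSup (le_add_self.trans h0) ht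
    have hw : w2 (l+1) t = 1 + t ^ l := by
      rw [w2, if_neg (by linarith), abs_of_nonneg ht', add_sub_cancel_right]
    have hwp : 0 < 1 + t ^ l := by positivity
    rw [hw, ← ENNReal.le_div_iff_mul_le (Or.inl (by simpa using hwp)) (Or.inl ENNReal.ofReal_ne_top),
      ← ENNReal.ofReal_div_of_pos hwp] at h1
    unfold lipT at h1
    have h2 := (le_iSup _ hxy).trans
      (aux_iSup (aux_iSup ((le_iSup _ q).trans (le_self_add.trans h1)) hx) hy)
    have h3 := (ENNReal.ofReal_le_ofReal_iff (by positivity)).1 h2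
    have hn : 0 < ‖x - y‖ := norm_pos_iff.2 (sub_ne_zero.2 hxy)
    rw [div_le_iff₀ hn] at h3
    refine h3.trans (mul_le_mul_of_nonneg_right ?_ hn.le)
    have h4 := aux_w' l t (by linarith) ht'
    have h5 : (2:ℝ) ^ l ≤ 2 ^ (l+1) :=
      Real.rpow_le_rpow_of_exponent_le (by norm_num) (by linarith)
    rw [hAdef, mul_assoc, div_eq_mul_one_div]
    refine mul_le_mul_of_nonneg_left (h4.trans ?_) hM0
    exact mul_le_mul_of_nonneg_right h5 (by positivity)
  have hωL : ∀ x ∈ D', ∀ y ∈ D', ‖ω x - ω y‖ ≤ K * ‖x - y‖ := by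
    intro x hx y hy
    rcases eq_or_ne x y with rfl | hxy
    · simp
    unfold lipNormOn at hωK
    have h2 := (le_iSup _ hxy).trans (aux_iSup (aux_iSup (le_self_add.trans hωK) hx) hy)
    have h3 := (ENNReal.ofReal_le_ofReal_iff hK).1 h2
    have hn : 0 < ‖x - y‖ := norm_pos_iff.2 (sub_ne_zero.2 hxy)
    rwa [div_le_iff₀ hn] at h3
  have hκ2 : ∀ θ p t, κ θ p t = -∫ u in Ici (0:ℝ), g (θ + u • ω p) p (t + u) := by
    intro θ p t
    rw [hκ, aux_shift]
    simp
  have hJ : ∀ t ∈ Ici (0:ℝ), 0 ≤ ∫ u in Ici (0:ℝ), (1 + (t + u)) ^ (-l) := by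
    intro t ht
    refine setIntegral_nonneg measurableSet_Ici fun u hu => ?_
    exact Real.rpow_nonneg (by linarith [mem_Ici.1 hu, mem_Ici.1 ht]) _
  have hder : ∀ θ : E n, ∀ p₀ ∈ D', ∀ t ∈ Ici (0:ℝ),
        HasDerivWithinAt (fun s : ℝ => κ (θ + s • ω p₀) p₀ (t + s)) (g θ p₀ t) (Ici (-t)) 0 :=
    fun θ p hp t ht => kap_deriv hl hA hg hM1 hκ θ hp ht
  have hsup : ∀ p ∈ D', ∀ t ∈ Ici (0:ℝ), (⨆ θ : E n, (‖κ θ p t‖₊ : ℝ≥0∞)) ≤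
      ENNReal.ofReal (A * ∫ u in Ici (0:ℝ), (1 + (t + u)) ^ (-l)) := by
    intro p hp t ht
    refine iSup_le fun q => ?_
    rw [← enorm_eq_nnnorm, ← ofReal_norm]
    exact ENNReal.ofReal_le_ofReal (kap_bound hl hA hM1 hκ2 q hp ht)
  have hlim : ∀ p₀ ∈ D', Tendsto (fun t : ℝ => ⨆ θ : E n, (‖κ θ p₀ t‖₊ : ℝ≥0∞)) atTop (𝓝 0) := by
    intro p hp
    have h1 : Tendsto (fun t : ℝ => A * ((1 + t) ^ (-(l - 1)) / (l - 1))) atTop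
        (𝓝 (A * (0 / (l - 1)))) :=
      (((tendsto_rpow_neg_atTop hl1).comp (tendsto_atTop_add_const_left _ 1 tendsto_id)).div_const
        _).const_mul A
    have h2 := ENNReal.tendsto_ofReal h1
    rw [zero_div, mul_zero, ENNReal.ofReal_zero] at h2
    refine tendsto_of_tendsto_of_tendsto_of_le_of_le' tendsto_const_nhds h2
      (Eventually.of_forall fun _ => zero_le) ?_
    filter_upwards [eventually_ge_atTop 0] with t ht
    refine (hsup p hp t ht).trans (le_of_eq ?_)
    rw [aux_integral l t hl ht, neg_sub]
  refine ⟨⟨kap_cont hl hA hg hω hM1 hκ2, ?_, ?_⟩, hder, hlim, ?_, ?_⟩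
  · intro q p t ht k
    rw [hκ2, hκ2]
    congr 1
    refine setIntegral_congr_fun measurableSet_Ici fun u hu => ?_
    rw [add_right_comm]
    exact hg.2.1 _ p _ (mem_Ici.2 (add_nonneg (mem_Ici.1 ht) (mem_Ici.1 hu))) k
  · intro p hp t ht
    obtain ⟨h1, h2⟩ := kap_holder hl hA hg hM1 hκ2 hp ht
    exact ⟨h1.contDiffOn, h2.trans_lt ENNReal.ofReal_lt_top⟩
  · intro κ' _ hder' hlim' θ p hp t ht
    have hz : ∀ (f : E n → E n → ℝ → ℝ),
        Tendsto (fun t : ℝ => ⨆ θ : E n, (‖f θ p t‖₊ : ℝ≥0∞)) atTop (𝓝 0) →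
        ∀ (θ : E n) (t : ℝ), Tendsto (fun s : ℝ => f (θ + s • ω p) p (t + s)) atTop (𝓝 0) := by
      intro f hf θ t
      rw [tendsto_zero_iff_enorm_tendsto_zero]
      refine tendsto_of_tendsto_of_tendsto_of_le_of_le tendsto_const_nhds
        (hf.comp (tendsto_atTop_add_const_left _ t tendsto_id)) (fun _ => zero_le) (fun s => ?_)
      exact le_iSup (fun q => (‖f q p (t + s)‖₊ : ℝ≥0∞)) (θ + s • ω p)
    refine sub_eq_zero.1 (uniq_aux (fun θ t => κ' θ p t - κ θ p t) (ω p) ?_ ?_ θ t ht)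
    · intro θ t ht
      have := (hder' θ p hp t ht).sub (hder θ p hp t ht)
      rwa [sub_self] at this
    · intro θ t _
      have := (hz κ' (hlim' p hp) θ t).sub (hz κ (hlim p hp) θ t)
      rwa [sub_zero] at this
  · rw [hMe, ← ENNReal.ofReal_mul (by positivity)]
    have e : 2 ^ (l+1) * (4 / l + (K + 2) * (2 / (l - 1))) * M =
        A * (4 / l) + A * (K + 2) * (2 / (l - 1)) := by
      rw [hAdef]; ring
    rw [e, ENNReal.ofReal_add (by positivity) (by positivity)]
    unfold wnormDp
    refine add_le_add ?_ ?_
    · refine iSup₂_le fun p hp => iSup₂_le fun t ht => ?_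
      have ht' : 0 ≤ t := ht
      refine (mul_le_mul_left (kap_holder hl hA hg hM1 hκ2 hp ht).2 _).trans ?_
      rw [w1, if_neg hl0.ne', abs_of_nonneg ht', ← ENNReal.ofReal_mul' (by positivity)]
      refine ENNReal.ofReal_le_ofReal ?_
      have h := aux_J (l+1) t (by linarith) ht
      rw [add_sub_cancel_right] at h
      have := mul_le_mul_of_nonneg_left h hA
      calc _ = 2 * (A * ((∫ u in Ici (0:ℝ), (1 + (t + u)) ^ (-(l+1))) * (1 + t ^ l))) := by ring
        _ ≤ 2 * (A * (2 / l)) := by linarith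
        _ = _ := by ring
    · refine iSup₂_le fun t ht => ?_
      have ht' : 0 ≤ t := ht
      have hJt := hJ t ht
      have hlip : lipT D' κ t ≤
          ENNReal.ofReal (A * (K + 2) * ∫ u in Ici (0:ℝ), (1 + (t + u)) ^ (-l)) := by
        have e' : (A * (K + 2) * ∫ u in Ici (0:ℝ), (1 + (t + u)) ^ (-l)) =
          (A * (K + 1) * ∫ u in Ici (0:ℝ), (1 + (t + u)) ^ (-l)) +
            A * ∫ u in Ici (0:ℝ), (1 + (t + u)) ^ (-l) := by ring
        rw [e', ENNReal.ofReal_add (by positivity) (by positivity)]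
        unfold lipT
        refine add_le_add ?_ ?_
        · refine iSup_le fun q => iSup₂_le fun x hx => iSup₂_le fun y hy => iSup_le fun hxy => ?_
          have hn : 0 < ‖x - y‖ := norm_pos_iff.2 (sub_ne_zero.2 hxy)
          refine ENNReal.ofReal_le_ofReal ?_
          rw [div_le_iff₀ hn]
          exact kap_lip hl hA hσ hg hM1 hM2 hωL hκ2 q hx hy ht
        · refine iSup_le fun q => iSup₂_le fun p hp => ?_
          exact (le_iSup (fun q => (‖κ q p t‖₊ : ℝ≥0∞)) q).trans (hsup p hp t ht)
      refine (mul_le_mul_left hlip _).trans ?_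
      rw [w2, if_neg hl0.ne', abs_of_nonneg ht', ← ENNReal.ofReal_mul' (by positivity)]
      refine ENNReal.ofReal_le_ofReal ?_
      rw [mul_assoc]
      exact mul_le_mul_of_nonneg_left (aux_J l t hl ht) (by positivity)

end Bias
end
end

section
/- Let σ ≥ 1, let A ⊂ ℝⁿ be a closed set, and let l, m ≥ 1 (the statement also holds when l = m = 0 or when exactly one of l, m is 0). For all f, g in D_σ, the product satisfies |fg|_{σ,l+m,L(A)} ≤ C(σ) (|f|_{0,l,L(A)} |g|_{σ,m,L(A)} + |f|_{σ,l,L(A)} |g|_{0,m,L(A)}) for a constant C(σ) depending only on n and σ. -/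
open scoped ENNReal NNReal Topology
open Filter Metric Set MeasureTheory

noncomputable section

namespace Bias

variable {n : ℕ}

variable {E' F : Type*} [NormedAddCommGroup E'] [NormedSpace ℝ E']
  [NormedAddCommGroup F] [NormedSpace ℝ F]

theorem seqA : ∀ (i : ℕ) (δ : ℝ), 0 < δ → ∃ C : ℝ, 0 < C ∧ ∀ (k : ℕ) (m : ℕ → ℝ),
    (∀ j ≤ k, 0 ≤ m j) →
    (∀ j, j + 2 ≤ k → ∀ h : ℝ, 0 < h → m (j+1) ≤ 2 / h * m j + h * m (j+2)) →
    i + 1 ≤ k → m i ≤ C * m 0 + δ * m (i+1) := by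
  intro i
  induction i with
  | zero =>
    intro δ hδ
    refine ⟨1, one_pos, fun k m h0 _ hk => ?_⟩
    have := mul_nonneg hδ.le (h0 (0+1) hk)
    linarith
  | succ i ih =>
    intro δ hδ
    obtain ⟨C, hC, H⟩ := ih (δ / 8) (by positivity)
    refine ⟨8 / δ * C, by positivity, fun k m h0 h1 hk => ?_⟩
    have e1 := H k m h0 h1 (by omega)
    have e2 := h1 i (by omega) (δ / 2) (by positivity)
    have e3 : 2 / (δ/2) * m i ≤ 2 / (δ/2) * (C * m 0 + δ / 8 * m (i+1)) := by gcongr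
    have e4 : 2 / (δ/2) * (C * m 0 + δ / 8 * m (i+1)) = 4 / δ * C * m 0 + 1/2 * m (i+1) := by
      field_simp; ring
    have e5 : 8 / δ * C * m 0 = 2 * (4 / δ * C * m 0) := by ring
    show m (i+1) ≤ 8 / δ * C * m 0 + δ * m (i+2)
    linarith

theorem seqB (k : ℕ) (hk : 1 ≤ k) : ∃ C : ℝ, 1 ≤ C ∧ ∀ (m : ℕ → ℝ) (s : ℝ), 0 ≤ s →
    (∀ j ≤ k, 0 ≤ m j) →
    (∀ j, j + 2 ≤ k → ∀ h : ℝ, 0 < h → m (j+1) ≤ 2 / h * m j + h * m (j+2)) →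
    m k ≤ 2 * m (k-1) + s →
    ∀ i ≤ k, m i ≤ C * (m 0 + s) := by
  have key : ∀ j : ℕ, ∃ C : ℝ, 1 ≤ C ∧ ∀ (m : ℕ → ℝ) (s : ℝ), 0 ≤ s →
    (∀ j ≤ k, 0 ≤ m j) →
    (∀ j, j + 2 ≤ k → ∀ h : ℝ, 0 < h → m (j+1) ≤ 2 / h * m j + h * m (j+2)) →
    m k ≤ 2 * m (k-1) + s → ∀ i ≤ k, k ≤ i + j → m i ≤ C * (m 0 + s) := by
    intro j
    induction j with
    | zero =>
      obtain ⟨C, hC, H⟩ := seqA (k-1) (1/4) (by norm_num)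
      refine ⟨4 * C + 2, by linarith, fun m s hs h0 h1 h2 i hi hj => ?_⟩
      have : i = k := by omega
      subst this
      have e := H i m h0 h1 (by omega)
      rw [show i - 1 + 1 = i by omega] at e
      have := h0 0 (by omega)
      have : 0 ≤ C * s := by positivity
      nlinarith
    | succ j ih =>
      obtain ⟨C1, hC1, H1⟩ := ih
      obtain ⟨C, hC, H⟩ := seqA (k-(j+1)) 1 (by norm_num)
      refine ⟨C + C1, by linarith, fun m s hs h0 h1 h2 i hi hj => ?_⟩
      have z := h0 0 (by omega)
      have cs : 0 ≤ C * s := by positivity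
      have cm : 0 ≤ C * m 0 := by positivity
      by_cases hh : k ≤ i + j
      · have := H1 m s hs h0 h1 h2 i hi hh
        nlinarith
      · have : i = k - (j+1) := by omega
        rw [← this] at H
        have e := H k m h0 h1 (by omega)
        have := H1 m s hs h0 h1 h2 (i+1) (by omega) (by omega)
        nlinarith
  obtain ⟨C, hC, H⟩ := key k
  exact ⟨C, hC, fun m s hs h0 h1 h2 i hi => H m s hs h0 h1 h2 i hi (by omega)⟩

theorem final_opt {K a A b B X : ℝ} (hK : 0 ≤ K) (ha : 0 ≤ a) (hb : 0 ≤ b) (haA : a ≤ A) (hbB : b ≤ B)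
    (H : ∀ u : ℝ, 0 < u → u ≤ 1 → u * X ≤ K * ((a + u * A) * (b + u * B))) :
    X ≤ 2 * K * (a * B + A * b) := by
  have hA := ha.trans haA
  have hB := hb.trans hbB
  by_cases h0 : a * b = 0
  · have key : ∀ u : ℝ, 0 < u → u ≤ 1 → X ≤ K * (a * B + A * b) + K * (A * B) * u := by
      intro u hu hu1
      have := H u hu hu1
      have e : K * ((a + u * A) * (b + u * B)) = u * (K * (a * B + A * b) + K * (A * B) * u) := by
        linear_combination K * h0
      rw [e] at this
      exact le_of_mul_le_mul_left this hu
    have : X ≤ K * (a * B + A * b) := by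
      apply le_of_forall_pos_le_add
      intro η hη
      have hD : 0 ≤ K * (A * B) := by positivity
      have h1 := key (min 1 (η / (K * (A*B) + 1))) (by positivity) (min_le_left _ _)
      have h2 : K * (A * B) * min 1 (η / (K * (A*B) + 1)) ≤ K * (A * B) * (η / (K * (A*B) + 1)) := by
        gcongr; exact min_le_right _ _
      have h3 : K * (A * B) * (η / (K * (A*B) + 1)) ≤ η := by
        rw [mul_div_assoc', div_le_iff₀ (by positivity)]; nlinarith
      linarith
    have : 0 ≤ K * (a * B + A * b) := by positivity
    linarith
  · have ha' : 0 < a := lt_of_le_of_ne ha (fun h => h0 (by rw [← h]; ring))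
    have hb' : 0 < b := lt_of_le_of_ne hb (fun h => h0 (by rw [← h]; ring))
    have hA' := ha'.trans_le haA
    have hB' := hb'.trans_le hbB
    set p := Real.sqrt (a * b) with hp
    set q := Real.sqrt (A * B) with hq
    have hp0 : 0 < p := Real.sqrt_pos.2 (by positivity)
    have hq0 : 0 < q := Real.sqrt_pos.2 (by positivity)
    have hpp : p * p = a * b := Real.mul_self_sqrt (by positivity)
    have hqq : q * q = A * B := Real.mul_self_sqrt (by positivity)
    have hpq : p ≤ q := Real.sqrt_le_sqrt (by gcongr)
    have h := H (p / q) (by positivity) ((div_le_one hq0).2 hpq)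
    have h2 : 2 * (p * q) ≤ a * B + A * b := by
      have : (p * q) ^ 2 = (a * B) * (A * b) := by
        linear_combination q*q * hpp + a * b * hqq
      apply abs_le_of_sq_le_sq' _ (by positivity) |>.2
      nlinarith [sq_nonneg (a * B - A * b)]
    have e : K * ((a + p / q * A) * (b + p / q * B)) = p / q * (K * (2 * (p * q) + (a * B + A * b))) := by
      field_simp
      linear_combination (-K*q^2) * hpp - K *p^2* hqq
    rw [e] at h
    have h3 := le_of_mul_le_mul_left h (by positivity)
    nlinarith

section ana
variable {V W : Type*} [NormedAddCommGroup V] [NormedSpace ℝ V]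
  [NormedAddCommGroup W] [NormedSpace ℝ W]

theorem oneStep {G : V → W} (hG : Differentiable ℝ G) {M K h : ℝ} (hh : 0 < h) (hK : 0 ≤ K)
    (hM : ∀ x, ‖G x‖ ≤ M) (x : V)
    (hd : ∀ z, ‖z - x‖ ≤ h → ‖fderiv ℝ G z - fderiv ℝ G x‖ ≤ K) :
    ‖fderiv ℝ G x‖ ≤ 2 / h * M + K := by
  have hM0 : 0 ≤ M := (norm_nonneg _).trans (hM x)
  apply ContinuousLinearMap.opNorm_le_bound _ (by positivity)
  intro v
  by_cases hv : v = 0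
  · simp [hv]
  have hv' : 0 < ‖v‖ := norm_pos_iff.2 hv
  set c := h / ‖v‖ with hc
  have hc0 : 0 < c := by positivity
  have hcn : ‖c • v‖ = h := by
    rw [norm_smul, Real.norm_of_nonneg hc0.le, hc]; field_simp
  have key := Convex.norm_image_sub_le_of_norm_hasFDerivWithin_le' (𝕜 := ℝ)
    (f := G) (C := K) (s := Metric.closedBall x h) (x := x) (y := x + c • v)
    (f' := fderiv ℝ G) (φ := fderiv ℝ G x)
    (fun z _ => (hG z).hasFDerivAt.hasFDerivWithinAt)
    (fun z hz => hd z (by simpa [dist_eq_norm] using hz))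
    (convex_closedBall x h) (by simp [hh.le]) (by simp [hcn])
  rw [add_sub_cancel_left, hcn, map_smul] at key
  have h1 : ‖c • fderiv ℝ G x v‖ ≤ 2 * M + K * h := by
    have e : c • fderiv ℝ G x v = G (x + c • v) - G x - (G (x + c • v) - G x - c • fderiv ℝ G x v) := by
      abel
    rw [e]
    have := norm_sub_le (G (x + c • v) - G x) (G (x + c • v) - G x - c • fderiv ℝ G x v)
    have := norm_sub_le (G (x + c • v)) (G x)
    have := hM x
    have := hM (x + c • v)
    linarith
  rw [norm_smul, Real.norm_of_nonneg hc0.le] at h1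
  have e2 : (2 / h * M + K) * ‖v‖ = (2 * M + K * h) / c := by
    rw [hc]; field_simp
  rw [e2, le_div_iff₀ hc0]
  linarith

theorem fderiv_iter_sub (f : V → W) (i : ℕ) (x y : V) :
    ‖fderiv ℝ (iteratedFDeriv ℝ i f) x - fderiv ℝ (iteratedFDeriv ℝ i f) y‖
      = ‖iteratedFDeriv ℝ (i+1) f x - iteratedFDeriv ℝ (i+1) f y‖ := by
  rw [fderiv_iteratedFDeriv, Function.comp_apply, Function.comp_apply]
  exact LinearIsometryEquiv.norm_map (continuousMultilinearCurryLeftEquiv ℝ (fun _ : Fin (i+1) => V) W)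
    (iteratedFDeriv ℝ (i+1) f x - iteratedFDeriv ℝ (i+1) f y)

theorem iter_lip {f : V → W} {k i : ℕ} (hf : ContDiff ℝ k f) (hi : i < k) {M : ℝ}
    (hM : ∀ x, ‖iteratedFDeriv ℝ (i+1) f x‖ ≤ M) (x y : V) :
    ‖iteratedFDeriv ℝ i f x - iteratedFDeriv ℝ i f y‖ ≤ M * ‖x - y‖ := by
  apply Convex.norm_image_sub_le_of_norm_fderiv_le (𝕜 := ℝ) (s := univ) _ _ convex_univ
    (mem_univ _) (mem_univ _)
  · intro z _
    exact (hf.differentiable_iteratedFDeriv (by exact_mod_cast hi)) z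
  · intro z _
    rw [norm_fderiv_iteratedFDeriv]
    exact hM z

/-- real-number data for a Holder function -/
structure HData (k : ℕ) (α : ℝ) (f : V → W) (a A : ℝ) : Prop where
  cd : ContDiff ℝ k f
  h0 : ∀ x, ‖f x‖ ≤ a
  hi : ∀ i ≤ k, ∀ x, ‖iteratedFDeriv ℝ i f x‖ ≤ A
  hh : ∀ x y, ‖iteratedFDeriv ℝ k f x - iteratedFDeriv ℝ k f y‖ ≤ 2 * A * ‖x - y‖ ^ α

theorem interp (k : ℕ) (hk : 1 ≤ k) : ∃ C : ℝ, 1 ≤ C ∧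
    ∀ (f : V → W) (a A α ε : ℝ), 0 ≤ α → 0 < ε → HData k α f a A →
    ∀ i ≤ k, ∀ x, ε ^ i * ‖iteratedFDeriv ℝ i f x‖ ≤ C * (a + ε ^ k * ε ^ α * A) := by
  obtain ⟨C, hC, H⟩ := seqB k hk
  refine ⟨2 * C, by linarith, fun f a A α ε hα hε D i hi x => ?_⟩
  have hA : 0 ≤ A := (norm_nonneg _).trans (D.hi 0 (by omega) x)
  have ha : 0 ≤ a := (norm_nonneg _).trans (D.h0 x)
  set M : ℕ → ℝ := fun j => ⨆ x, ‖iteratedFDeriv ℝ j f x‖ with hMdef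
  have bdd : ∀ j ≤ k, BddAbove (range fun x => ‖iteratedFDeriv ℝ j f x‖) := by
    intro j hj
    exact ⟨A, by rintro _ ⟨x, rfl⟩; exact D.hi j hj x⟩
  have hM : ∀ j ≤ k, ∀ x, ‖iteratedFDeriv ℝ j f x‖ ≤ M j := fun j hj x => le_ciSup (bdd j hj) x
  have hM0 : ∀ j ≤ k, 0 ≤ M j := fun j hj => (norm_nonneg _).trans (hM j hj x)
  have hMa : M 0 ≤ a := ciSup_le fun x => by rw [norm_iteratedFDeriv_zero]; exact D.h0 x
  have st : ∀ j, j + 1 ≤ k → ∀ h K : ℝ, 0 < h → 0 ≤ K →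
      (∀ x z, ‖z - x‖ ≤ h → ‖iteratedFDeriv ℝ (j+1) f z - iteratedFDeriv ℝ (j+1) f x‖ ≤ K) →
      M (j+1) ≤ 2 / h * M j + K := by
    intro j hj h K hh hK hd
    apply ciSup_le
    intro x
    rw [← norm_fderiv_iteratedFDeriv]
    apply oneStep (D.cd.differentiable_iteratedFDeriv (by exact_mod_cast hj)) hh hK (hM j (by omega))
    intro z hz
    rw [fderiv_iter_sub]
    exact hd x z hz
  have fin := H (fun j => ε ^ j * M j) (2 * (ε ^ k * ε ^ α * A)) (by positivity)
    (fun j hj => mul_nonneg (by positivity) (hM0 j hj)) ?_ ?_ i hi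
  · have := hM i hi x
    have e1 : ε ^ i * ‖iteratedFDeriv ℝ i f x‖ ≤ ε ^ i * M i := by gcongr
    have e2 : C * (ε ^ 0 * M 0 + 2 * (ε ^ k * ε ^ α * A)) ≤ C * (2 * a + 2 * (ε ^ k * ε ^ α * A)) := by
      rw [pow_zero, one_mul]; gcongr; linarith
    calc _ ≤ _ := e1
      _ ≤ _ := fin
      _ ≤ _ := e2
      _ = _ := by ring
  · intro j hj h hh
    have m2 := hM0 (j+2) hj
    have := st j (by omega) (ε * h) (M (j+2) * (ε * h)) (by positivity) (by positivity) (by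
      intro x z hz
      refine (iter_lip D.cd (i := j+1) (by omega) (hM (j+2) hj) z x).trans ?_
      gcongr)
    calc ε ^ (j+1) * M (j+1) ≤ ε ^ (j+1) * (2 / (ε * h) * M j + M (j+2) * (ε * h)) := by gcongr
      _ = _ := by field_simp; ring
  · obtain ⟨j, rfl⟩ : ∃ j, k = j + 1 := ⟨k - 1, by omega⟩
    have := st j le_rfl ε (2 * A * ε ^ α) hε (by positivity) (by
      intro x z hz
      refine (D.hh z x).trans ?_
      gcongr)
    calc ε ^ (j+1) * M (j+1) ≤ ε ^ (j+1) * (2 / ε * M j + 2 * A * ε ^ α) := by gcongr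
      _ = _ := by
        simp only [Nat.add_sub_cancel]
        field_simp
        ring

theorem interp_diff {k : ℕ} {C : ℝ} (hC : 1 ≤ C) {f : V → W} {a A α ε : ℝ}
    (hα : 0 ≤ α) (hα1 : α < 1) (hε : 0 < ε) (D : HData k α f a A)
    (H : ∀ i ≤ k, ∀ x, ε ^ i * ‖iteratedFDeriv ℝ i f x‖ ≤ C * (a + ε ^ k * ε ^ α * A))
    (i : ℕ) (hi : i ≤ k) (x y : V) :
    ε ^ i * ε ^ α * ‖iteratedFDeriv ℝ i f x - iteratedFDeriv ℝ i f y‖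
      ≤ 2 * C * (a + ε ^ k * ε ^ α * A) * ‖x - y‖ ^ α := by
  have hA : 0 ≤ A := (norm_nonneg _).trans (D.hi 0 (by omega) x)
  have ha : 0 ≤ a := (norm_nonneg _).trans (D.h0 x)
  set T := a + ε ^ k * ε ^ α * A with hT
  have hT0 : 0 ≤ T := by positivity
  have hεα : 0 < ε ^ α := Real.rpow_pos_of_pos hε α
  by_cases hxy : x = y
  · subst hxy
    simp only [sub_self, norm_zero, mul_zero]
    have : (0:ℝ) ≤ 0 ^ α := Real.rpow_nonneg le_rfl _
    positivity
  have hr : 0 < ‖x - y‖ := norm_pos_iff.2 (sub_ne_zero.2 hxy)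
  set r := ‖x - y‖ with hrdef
  have hrα : 0 < r ^ α := Real.rpow_pos_of_pos hr α
  rcases hi.eq_or_lt with rfl | hlt
  · calc _ ≤ ε ^ i * ε ^ α * (2 * A * r ^ α) := by gcongr; exact D.hh x y
      _ = 2 * (ε ^ i * ε ^ α * A) * r ^ α := by ring
      _ ≤ 2 * (1 * T) * r ^ α := by
        have h9 : ε ^ i * ε ^ α * A ≤ 1 * T := by rw [hT]; linarith
        exact mul_le_mul_of_nonneg_right (by linarith) hrα.le
      _ ≤ 2 * (C * T) * r ^ α := by gcongr
      _ = _ := by ring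
  · rcases le_or_gt r ε with hle | hgt
    · have e1 : ε ^ α * r ≤ ε * r ^ α := by
        have a1 : r = r ^ α * r ^ (1 - α) := by rw [← Real.rpow_add hr]; simp
        have a2 : ε ^ α * ε ^ (1 - α) = ε := by rw [← Real.rpow_add hε]; simp
        have a3 : r ^ (1 - α) ≤ ε ^ (1 - α) := Real.rpow_le_rpow hr.le hle (by linarith)
        calc ε ^ α * r = ε ^ α * (r ^ α * r ^ (1 - α)) := by rw [← a1]
          _ ≤ ε ^ α * (r ^ α * ε ^ (1 - α)) := by gcongr
          _ = (ε ^ α * ε ^ (1 - α)) * r ^ α := by ring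
          _ = _ := by rw [a2]
      have e2 := iter_lip D.cd hlt (M := C * T / ε ^ (i+1)) (fun z => by
        rw [le_div_iff₀ (by positivity)]
        have := H (i+1) hlt z
        linarith) x y
      calc _ ≤ ε ^ i * ε ^ α * (C * T / ε ^ (i+1) * r) := by gcongr
        _ = ε ^ i * (C * T / ε ^ (i+1)) * (ε ^ α * r) := by ring
        _ ≤ ε ^ i * (C * T / ε ^ (i+1)) * (ε * r ^ α) := by gcongr
        _ = C * T * r ^ α := by field_simp; ring
        _ ≤ 2 * C * T * r ^ α := by
          have : 0 ≤ C * T * r ^ α := by positivity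
          linarith
    · have e1 : ε ^ α ≤ r ^ α := Real.rpow_le_rpow hε.le hgt.le hα
      have e2 := H i hi x
      have e3 := H i hi y
      calc _ = (ε ^ i * ‖iteratedFDeriv ℝ i f x - iteratedFDeriv ℝ i f y‖) * ε ^ α := by ring
        _ ≤ (ε ^ i * (‖iteratedFDeriv ℝ i f x‖ + ‖iteratedFDeriv ℝ i f y‖)) * r ^ α := by
          gcongr; exact norm_sub_le _ _
        _ ≤ (2 * C * T) * r ^ α := by
          exact mul_le_mul_of_nonneg_right (by linarith) hrα.le

theorem prod_diff {k : ℕ} {f g : V → ℝ} (hf : ContDiff ℝ k f) (hg : ContDiff ℝ k g) (x y : V) :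
    ‖iteratedFDeriv ℝ k (fun z => f z * g z) x - iteratedFDeriv ℝ k (fun z => f z * g z) y‖ ≤
    ∑ i ∈ Finset.range (k + 1), ((k.choose i : ℝ) *
      ‖iteratedFDeriv ℝ i f x - iteratedFDeriv ℝ i f y‖ * ‖iteratedFDeriv ℝ (k - i) g x‖
      + (k.choose i : ℝ) * ‖iteratedFDeriv ℝ i f y‖ *
        ‖iteratedFDeriv ℝ (k - i) g x - iteratedFDeriv ℝ (k - i) g y‖) := by
  set w := y - x with hw
  have hxw : x + w = y := by simp [hw]
  set fw : V → ℝ := fun z => f (z + w) with hfw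
  set gw : V → ℝ := fun z => g (z + w) with hgw
  have cfw : ContDiff ℝ k fw := hf.comp (contDiff_id.add contDiff_const)
  have cgw : ContDiff ℝ k gw := hg.comp (contDiff_id.add contDiff_const)
  have hle : ∀ i ∈ Finset.range (k+1), i ≤ k ∧ k - i ≤ k := fun i hi => by
    have := Finset.mem_range.1 hi
    omega
  have dsub : ∀ (u : V → ℝ), ContDiff ℝ k u → ∀ i ≤ k,
      iteratedFDeriv ℝ i (u - fun z => u (z + w)) x = iteratedFDeriv ℝ i u x - iteratedFDeriv ℝ i u y := by
    intro u hu i hi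
    have hu' : ContDiff ℝ i u := hu.of_le (by exact_mod_cast hi)
    have hu2 : ContDiff ℝ i (fun z => u (z + w)) := hu'.comp (contDiff_id.add contDiff_const)
    rw [iteratedFDeriv_sub_apply hu'.contDiffAt hu2.contDiffAt, iteratedFDeriv_comp_add_right, hxw]
  have e1 := dsub (fun z => f z * g z) (hf.mul hg) k le_rfl
  rw [← e1]
  have e2 : ((fun z => f z * g z) - fun z => f (z + w) * g (z + w))
      = (fun z => (f - fw) z * g z) + (fun z => fw z * (g - gw) z) := by
    funext z
    simp [hfw, hgw]
    ring
  have c1 : ContDiff ℝ k (fun z => (f - fw) z * g z) := (hf.sub cfw).mul hg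
  have c2 : ContDiff ℝ k (fun z => fw z * (g - gw) z) := cfw.mul (hg.sub cgw)
  rw [e2, iteratedFDeriv_add_apply c1.contDiffAt c2.contDiffAt, Finset.sum_add_distrib]
  refine (norm_add_le _ _).trans (add_le_add ?_ ?_)
  · refine (norm_iteratedFDeriv_mul_le (hf.sub cfw) hg x le_rfl).trans (le_of_eq ?_)
    apply Finset.sum_congr rfl
    intro i hi
    rw [← dsub f hf i (hle i hi).1]
    rfl
  · refine (norm_iteratedFDeriv_mul_le cfw (hg.sub cgw) x le_rfl).trans (le_of_eq ?_)
    apply Finset.sum_congr rfl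
    intro i hi
    rw [← dsub g hg _ (hle i hi).2, hfw, iteratedFDeriv_comp_add_right, hxw]
    rfl

theorem sum_choose_const (N : ℕ) (c : ℝ) :
    ∑ i ∈ Finset.range (N+1), (N.choose i : ℝ) * c = 2 ^ N * c := by
  rw [← Finset.sum_mul]
  congr 1
  exact_mod_cast Nat.sum_range_choose N

theorem prod_main (k : ℕ) (hk : 1 ≤ k) : ∃ K : ℝ, 1 ≤ K ∧
    ∀ (f g : V → ℝ) (a A b B α : ℝ), 0 ≤ α → α < 1 → a ≤ A → b ≤ B →
    HData k α f a A → HData k α g b B →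
    (∀ N ≤ k, ∀ x, ‖iteratedFDeriv ℝ N (fun z => f z * g z) x‖ ≤ K * (a * B + A * b)) ∧
    (∀ x y, x ≠ y → ‖iteratedFDeriv ℝ k (fun z => f z * g z) x -
      iteratedFDeriv ℝ k (fun z => f z * g z) y‖ / ‖x - y‖ ^ α ≤ K * (a * B + A * b)) := by
  obtain ⟨C, hC, H⟩ := interp (V := V) (W := ℝ) k hk
  refine ⟨2 * (2 ^ k * (4 * C ^ 2)), ?_, fun f g a A b B α hα hα1 haA hbB Df Dg => ?_⟩
  · have : (1:ℝ) ≤ 2 ^ k := one_le_pow₀ (by norm_num)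
    have : (1:ℝ) ≤ C ^ 2 := one_le_pow₀ hC
    nlinarith
  have ha : 0 ≤ a := (norm_nonneg _).trans (Df.h0 0)
  have hb : 0 ≤ b := (norm_nonneg _).trans (Dg.h0 0)
  have hA := ha.trans haA
  have hB := hb.trans hbB
  have eps : ∀ u : ℝ, 0 < u → u ≤ 1 → ∃ ε : ℝ, 0 < ε ∧ ε ≤ 1 ∧ ε ^ k * ε ^ α = u := by
    intro u hu hu1
    have hk' : (1:ℝ) ≤ k := by exact_mod_cast hk
    have hp : 0 < (k:ℝ) + α := by linarith
    refine ⟨u ^ (1 / ((k:ℝ) + α)), by positivity, Real.rpow_le_one hu.le hu1 (by positivity), ?_⟩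
    rw [← Real.rpow_natCast, ← Real.rpow_add (by positivity), ← Real.rpow_mul hu.le]
    rw [one_div_mul_cancel hp.ne', Real.rpow_one]
  constructor
  · intro N hN x
    apply final_opt (by positivity) ha hb haA hbB
    intro u hu hu1
    obtain ⟨ε, hε, hε1, rfl⟩ := eps u hu hu1
    have Hf := H f a A α ε hα hε Df
    have Hg := H g b B α ε hα hε Dg
    set Tf := a + ε ^ k * ε ^ α * A
    set Tg := b + ε ^ k * ε ^ α * B
    have hTf : 0 ≤ Tf := by positivity
    have hTg : 0 ≤ Tg := by positivity
    have l1 := norm_iteratedFDeriv_mul_le Df.cd Dg.cd x (n := N) (by exact_mod_cast hN)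
    have hεα : ε ^ α ≤ 1 := Real.rpow_le_one hε.le hε1 hα
    have hεk : ε ^ k ≤ ε ^ N := pow_le_pow_of_le_one hε.le hε1 hN
    calc ε ^ k * ε ^ α * _ ≤ ε ^ N * 1 * ∑ i ∈ Finset.range (N + 1), (N.choose i : ℝ) *
            ‖iteratedFDeriv ℝ i f x‖ * ‖iteratedFDeriv ℝ (N - i) g x‖ := by gcongr
      _ = ∑ i ∈ Finset.range (N + 1), (N.choose i : ℝ) *
            ((ε ^ i * ‖iteratedFDeriv ℝ i f x‖) * (ε ^ (N - i) * ‖iteratedFDeriv ℝ (N - i) g x‖)) := by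
          rw [mul_one, Finset.mul_sum]
          apply Finset.sum_congr rfl
          intro i hi
          have : i ≤ N := by have := Finset.mem_range.1 hi; omega
          rw [show ε ^ N = ε ^ i * ε ^ (N - i) by rw [← pow_add]; congr 1; omega]
          ring
      _ ≤ ∑ i ∈ Finset.range (N + 1), (N.choose i : ℝ) * ((C * Tf) * (C * Tg)) := by
          apply Finset.sum_le_sum
          intro i hi
          have : i ≤ N := by have := Finset.mem_range.1 hi; omega
          have h1 := Hf i (by omega) x
          have h2 := Hg (N - i) (by omega) x
          gcongr
      _ = 2 ^ N * ((C * Tf) * (C * Tg)) := sum_choose_const _ _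
      _ ≤ 2 ^ k * (4 * ((C * Tf) * (C * Tg))) := by
          have h3 : 0 ≤ (C * Tf) * (C * Tg) := by positivity
          have h4 : (2:ℝ) ^ N ≤ 2 ^ k := pow_le_pow_right₀ (by norm_num) hN
          exact mul_le_mul h4 (by linarith) h3 (by positivity)
      _ = _ := by ring
  · intro x y hxy
    have hr : 0 < ‖x - y‖ := norm_pos_iff.2 (sub_ne_zero.2 hxy)
    have hrα : 0 < ‖x - y‖ ^ α := Real.rpow_pos_of_pos hr α
    apply final_opt (by positivity) ha hb haA hbB
    intro u hu hu1
    obtain ⟨ε, hε, hε1, rfl⟩ := eps u hu hu1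
    have Hf := H f a A α ε hα hε Df
    have Hg := H g b B α ε hα hε Dg
    have Ff := interp_diff hC hα hα1 hε Df Hf
    have Fg := interp_diff hC hα hα1 hε Dg Hg
    set Tf := a + ε ^ k * ε ^ α * A
    set Tg := b + ε ^ k * ε ^ α * B
    have hTf : 0 ≤ Tf := by positivity
    have hTg : 0 ≤ Tg := by positivity
    rw [mul_div_assoc', div_le_iff₀ hrα]
    set R := ‖x - y‖ ^ α
    have l1 := prod_diff Df.cd Dg.cd x y
    calc ε ^ k * ε ^ α * _ ≤ ε ^ k * ε ^ α * _ := mul_le_mul_of_nonneg_left l1 hu.le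
      _ = ∑ i ∈ Finset.range (k + 1), (k.choose i : ℝ) *
            ((ε ^ i * ε ^ α * ‖iteratedFDeriv ℝ i f x - iteratedFDeriv ℝ i f y‖) *
              (ε ^ (k - i) * ‖iteratedFDeriv ℝ (k - i) g x‖) +
             (ε ^ i * ‖iteratedFDeriv ℝ i f y‖) *
              (ε ^ (k - i) * ε ^ α * ‖iteratedFDeriv ℝ (k - i) g x - iteratedFDeriv ℝ (k - i) g y‖)) := by
          rw [Finset.mul_sum]
          apply Finset.sum_congr rfl
          intro i hi
          have : i ≤ k := by have := Finset.mem_range.1 hi; omega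
          rw [show ε ^ k = ε ^ i * ε ^ (k - i) by rw [← pow_add]; congr 1; omega]
          ring
      _ ≤ ∑ i ∈ Finset.range (k + 1), (k.choose i : ℝ) *
            ((2 * C * Tf * R) * (C * Tg) + (C * Tf) * (2 * C * Tg * R)) := by
          apply Finset.sum_le_sum
          intro i hi
          have : i ≤ k := by have := Finset.mem_range.1 hi; omega
          have h1 := Hf i (by omega) y
          have h2 := Hg (k - i) (by omega) x
          have h3 := Ff i (by omega) x y
          have h4 := Fg (k - i) (by omega) x y
          gcongr
      _ = 2 ^ k * ((2 * C * Tf * R) * (C * Tg) + (C * Tf) * (2 * C * Tg * R)) := sum_choose_const _ _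
      _ = _ := by ring

end ana

theorem le_holder (σ : ℝ) (f : E n → ℝ) (i : ℕ) (hi : i ≤ ⌊σ⌋₊) (x : E n) :
    (‖iteratedFDeriv ℝ i f x‖₊ : ℝ≥0∞) ≤ holderNormOn σ univ f := by
  unfold holderNormOn cNormOn
  refine le_add_right ?_
  refine le_iSup_of_le (⟨i, by omega⟩ : Fin (⌊σ⌋₊ + 1)) (le_iSup_of_le x (le_iSup_of_le (mem_univ x) ?_))
  simp [iteratedFDerivWithin_univ]

theorem le_holder_zero (σ : ℝ) (f : E n → ℝ) (x : E n) :
    (‖f x‖₊ : ℝ≥0∞) ≤ holderNormOn σ univ f := by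
  have h := le_holder σ f 0 (by omega) x
  have e : ‖iteratedFDeriv ℝ 0 f x‖₊ = ‖f x‖₊ := NNReal.eq (norm_iteratedFDeriv_zero)
  rwa [e] at h

theorem holder_zero_le (σ : ℝ) (f : E n → ℝ) : holderNormOn 0 univ f ≤ holderNormOn σ univ f := by
  conv_lhs => unfold holderNormOn cNormOn
  simp only [Nat.floor_zero, Nat.cast_zero, if_true, add_zero]
  refine iSup_le fun i => iSup_le fun x => iSup_le fun _ => ?_
  have hi : (i : ℕ) = 0 := by
    have h1 := i.2
    have h2 : ⌊(0:ℝ)⌋₊ = 0 := Nat.floor_zero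
    omega
  rw [iteratedFDerivWithin_univ, hi]
  exact le_holder σ f 0 (by omega) x

theorem toReal_bound {x : ℝ} {S : ℝ≥0∞} (hS : S ≠ ⊤) (h : ENNReal.ofReal x ≤ S) : x ≤ S.toReal :=
  (ENNReal.ofReal_le_iff_le_toReal hS).1 h

theorem hdata {σ : ℝ} {f : E n → ℝ} (hf : HolderOn σ univ f) :
    HData ⌊σ⌋₊ (σ - ⌊σ⌋₊) f (holderNormOn 0 univ f).toReal (holderNormOn σ univ f).toReal := by
  have top : holderNormOn σ univ f ≠ ⊤ := hf.2.ne
  have top0 : holderNormOn 0 univ f ≠ ⊤ := ne_top_of_le_ne_top top (holder_zero_le σ f)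
  have hi : ∀ i ≤ ⌊σ⌋₊, ∀ x, ‖iteratedFDeriv ℝ i f x‖ ≤ (holderNormOn σ univ f).toReal := by
    intro i hi x
    apply toReal_bound top
    rw [ofReal_norm]
    exact le_holder σ f i hi x
  refine ⟨contDiffOn_univ.1 hf.1, fun x => ?_, hi, fun x y => ?_⟩
  · apply toReal_bound top0
    rw [ofReal_norm]
    exact le_holder_zero 0 f x
  · by_cases hs : (⌊σ⌋₊ : ℝ) = σ
    · have e : σ - (⌊σ⌋₊ : ℝ) = 0 := by linarith
      rw [e, Real.rpow_zero]
      have h1 := norm_sub_le (iteratedFDeriv ℝ ⌊σ⌋₊ f x) (iteratedFDeriv ℝ ⌊σ⌋₊ f y)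
      have h2 := hi _ le_rfl x
      have h3 := hi _ le_rfl y
      linarith
    · have hA : 0 ≤ (holderNormOn σ univ f).toReal := ENNReal.toReal_nonneg
      have hr0 : 0 ≤ ‖x - y‖ ^ (σ - (⌊σ⌋₊ : ℝ)) := by positivity
      by_cases hxy : x = y
      · subst hxy
        rw [sub_self (iteratedFDeriv ℝ ⌊σ⌋₊ f x), norm_zero]
        positivity
      have hr : 0 < ‖x - y‖ ^ (σ - (⌊σ⌋₊ : ℝ)) :=
        Real.rpow_pos_of_pos (norm_pos_iff.2 (sub_ne_zero.2 hxy)) _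
      have h1 : ‖iteratedFDeriv ℝ ⌊σ⌋₊ f x - iteratedFDeriv ℝ ⌊σ⌋₊ f y‖ /
          ‖x - y‖ ^ (σ - (⌊σ⌋₊ : ℝ)) ≤ (holderNormOn σ univ f).toReal := by
        apply toReal_bound top
        unfold holderNormOn
        rw [if_neg hs]
        refine le_add_left ?_
        refine le_iSup_of_le x (le_iSup_of_le (mem_univ x) (le_iSup_of_le y
          (le_iSup_of_le (mem_univ y) (le_iSup_of_le hxy ?_))))
        simp only [iteratedFDerivWithin_univ, le_refl]
      rw [div_le_iff₀ hr] at h1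
      nlinarith [mul_nonneg hA hr0]

theorem holder_mul (n : ℕ) (σ : ℝ) (hσ : 1 ≤ σ) : ∃ K : ℝ, 0 < K ∧ ∀ f g : E n → ℝ,
    HolderOn σ univ f → HolderOn σ univ g →
    holderNormOn σ univ (fun z => f z * g z) ≤ ENNReal.ofReal K *
      (holderNormOn 0 univ f * holderNormOn σ univ g +
        holderNormOn σ univ f * holderNormOn 0 univ g) := by
  obtain ⟨K, hK, H⟩ := prod_main (V := E n) ⌊σ⌋₊ (Nat.one_le_floor_iff _ |>.2 hσ)
  refine ⟨2 * K, by linarith, fun f g hf hg => ?_⟩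
  have topf : holderNormOn σ univ f ≠ ⊤ := hf.2.ne
  have topf0 : holderNormOn 0 univ f ≠ ⊤ := ne_top_of_le_ne_top topf (holder_zero_le σ f)
  have topg : holderNormOn σ univ g ≠ ⊤ := hg.2.ne
  have topg0 : holderNormOn 0 univ g ≠ ⊤ := ne_top_of_le_ne_top topg (holder_zero_le σ g)
  have h0 : 0 ≤ σ - (⌊σ⌋₊ : ℝ) := by linarith [Nat.floor_le (show 0 ≤ σ by linarith)]
  have h1 : σ - (⌊σ⌋₊ : ℝ) < 1 := by linarith [Nat.lt_floor_add_one σ]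
  obtain ⟨P, Q⟩ := H f g _ _ _ _ _ h0 h1
    (ENNReal.toReal_mono topf (holder_zero_le σ f)) (ENNReal.toReal_mono topg (holder_zero_le σ g))
    (hdata hf) (hdata hg)
  set a := (holderNormOn 0 univ f).toReal with ha
  set A := (holderNormOn σ univ f).toReal with hA
  set b := (holderNormOn 0 univ g).toReal with hb
  set B := (holderNormOn σ univ g).toReal with hB
  have a0 : 0 ≤ a := ENNReal.toReal_nonneg
  have A0 : 0 ≤ A := ENNReal.toReal_nonneg
  have b0 : 0 ≤ b := ENNReal.toReal_nonneg
  have B0 : 0 ≤ B := ENNReal.toReal_nonneg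
  rw [← ENNReal.ofReal_toReal topf, ← ENNReal.ofReal_toReal topf0, ← ENNReal.ofReal_toReal topg,
    ← ENNReal.ofReal_toReal topg0, ← ha, ← hA, ← hb, ← hB, ← ENNReal.ofReal_mul a0,
    ← ENNReal.ofReal_mul A0, ← ENNReal.ofReal_add (by positivity) (by positivity),
    ← ENNReal.ofReal_mul (by positivity),
    show 2 * K * (a * B + A * b) = K * (a * B + A * b) + K * (a * B + A * b) by ring,
    ENNReal.ofReal_add (by positivity) (by positivity)]
  unfold holderNormOn cNormOn
  refine add_le_add ?_ ?_
  · refine iSup_le fun i => iSup_le fun x => iSup_le fun _ => ?_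
    rw [iteratedFDerivWithin_univ]
    have := ENNReal.ofReal_le_ofReal (P i (by omega) x)
    rwa [ofReal_norm] at this
  · split_ifs
    · exact zero_le
    · refine iSup_le fun x => iSup_le fun _ => iSup_le fun y => iSup_le fun _ => iSup_le fun hxy => ?_
      rw [iteratedFDerivWithin_univ]
      exact ENNReal.ofReal_le_ofReal (Q x y hxy)

theorem w1_mul {l m : ℝ} (hl : l = 0 ∨ 1 ≤ l) (hm : m = 0 ∨ 1 ≤ m) (t : ℝ) :
    w1 (l + m) t ≤ w1 l t * w1 m t := by
  rcases hl with rfl | hl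
  · simp [w1]
  rcases hm with rfl | hm
  · simp [w1]
  have e : |t| ^ (l + m) = |t| ^ l * |t| ^ m := Real.rpow_add_of_nonneg (abs_nonneg t) (by linarith) (by linarith)
  simp only [w1, if_neg (show l ≠ 0 by linarith), if_neg (show m ≠ 0 by linarith),
    if_neg (show l + m ≠ 0 by linarith), e]
  have : 0 ≤ |t| ^ l := by positivity
  have : 0 ≤ |t| ^ m := by positivity
  nlinarith

theorem w1_nonneg (l t : ℝ) : 0 ≤ w1 l t := by
  unfold w1; split_ifs <;> positivity

theorem w2_nonneg (l t : ℝ) : 0 ≤ w2 l t := by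
  unfold w2; split_ifs <;> positivity

theorem w2_mul {l m : ℝ} (hl : l = 0 ∨ 1 ≤ l) (hm : m = 0 ∨ 1 ≤ m) (t : ℝ) :
    w2 (l + m) t ≤ 2 * (w1 l t * w2 m t) := by
  rcases hl with rfl | hl
  · have := w2_nonneg m t
    simp [w1]
    linarith
  rcases hm with rfl | hm
  · simp only [w1, w2, if_neg (show l ≠ 0 by linarith), add_zero, if_true, mul_one]
    have h0 : 0 ≤ |t| ^ l := by positivity
    rcases le_total |t| 1 with h | h
    · have := Real.rpow_le_one (abs_nonneg t) h (show 0 ≤ l - 1 by linarith)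
      linarith
    · have := Real.rpow_le_rpow_of_exponent_le h (show l - 1 ≤ l by linarith)
      linarith
  have e : |t| ^ (l + m - 1) = |t| ^ l * |t| ^ (m - 1) := by
    rw [← Real.rpow_add_of_nonneg (abs_nonneg t) (by linarith) (by linarith)]
    congr 1; ring
  simp only [w1, w2, if_neg (show l ≠ 0 by linarith), if_neg (show m ≠ 0 by linarith),
    if_neg (show l + m ≠ 0 by linarith), e]
  have : 0 ≤ |t| ^ l := by positivity
  have : 0 ≤ |t| ^ (m - 1) := by positivity
  nlinarith

/-- sup norm of the time slice -/
def supT (A : Set (E n)) (f : E n → E n → ℝ → ℝ) (t : ℝ) : ℝ≥0∞ :=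
  ⨆ q : E n, ⨆ p ∈ A, (‖f q p t‖₊ : ℝ≥0∞)

theorem le_supT {A : Set (E n)} (f : E n → E n → ℝ → ℝ) (t : ℝ) (q : E n) {p : E n} (hp : p ∈ A) :
    (‖f q p t‖₊ : ℝ≥0∞) ≤ supT A f t :=
  le_iSup_of_le q (le_iSup_of_le p (le_iSup_of_le hp le_rfl))

/-- Lipschitz seminorm of the time slice -/
def semT (A : Set (E n)) (f : E n → E n → ℝ → ℝ) (t : ℝ) : ℝ≥0∞ :=
  ⨆ q : E n, ⨆ x ∈ A, ⨆ y ∈ A, ⨆ _ : x ≠ y, ENNReal.ofReal (‖f q x t - f q y t‖ / ‖x - y‖)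

theorem le_semT {A : Set (E n)} (f : E n → E n → ℝ → ℝ) (t : ℝ) (q : E n) {x y : E n} (hx : x ∈ A)
    (hy : y ∈ A) (hxy : x ≠ y) :
    ENNReal.ofReal (‖f q x t - f q y t‖ / ‖x - y‖) ≤ semT A f t :=
  le_iSup_of_le q (le_iSup_of_le x (le_iSup_of_le hx (le_iSup_of_le y (le_iSup_of_le hy
    (le_iSup_of_le hxy le_rfl)))))

theorem lipT_eq (A : Set (E n)) (f : E n → E n → ℝ → ℝ) (t : ℝ) :
    lipT A f t = semT A f t + supT A f t := rfl

theorem supT_le_wnormD (σ l : ℝ) (A : Set (E n)) (f : E n → E n → ℝ → ℝ) (t : ℝ) :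
    supT A f t * ENNReal.ofReal (w1 l t) ≤ wnormD σ l A f := by
  unfold supT
  simp only [ENNReal.iSup_mul]
  refine iSup_le fun q => iSup_le fun p => iSup_le fun hp => ?_
  unfold wnormD
  refine le_add_right (le_iSup_of_le p (le_iSup_of_le hp (le_iSup_of_le t ?_)))
  gcongr
  exact le_holder_zero σ (fun q => f q p t) q

theorem lipT_le_wnormD (σ l : ℝ) (A : Set (E n)) (f : E n → E n → ℝ → ℝ) (t : ℝ) :
    lipT A f t * ENNReal.ofReal (w2 l t) ≤ wnormD σ l A f := by
  unfold wnormD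
  exact le_add_left (le_iSup_of_le t le_rfl)

theorem holder_le_wnormD (σ l : ℝ) (A : Set (E n)) (f : E n → E n → ℝ → ℝ) {p : E n} (hp : p ∈ A) (t : ℝ) :
    holderNormOn σ univ (fun q => f q p t) * ENNReal.ofReal (w1 l t) ≤ wnormD σ l A f := by
  unfold wnormD
  exact le_add_right (le_iSup_of_le p (le_iSup_of_le hp (le_iSup_of_le t le_rfl)))

theorem lipT_mul (A : Set (E n)) (f g : E n → E n → ℝ → ℝ) (t : ℝ) :
    lipT A (fun q p t => f q p t * g q p t) t ≤ supT A f t * lipT A g t + lipT A f t * supT A g t := by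
  have h1 : semT A (fun q p t => f q p t * g q p t) t ≤ supT A f t * semT A g t + semT A f t * supT A g t := by
    refine iSup_le fun q => iSup_le fun x => iSup_le fun hx => iSup_le fun y => iSup_le fun hy =>
      iSup_le fun hxy => ?_
    have r : ‖f q x t * g q x t - f q y t * g q y t‖ / ‖x - y‖ ≤
        ‖f q x t‖ * (‖g q x t - g q y t‖ / ‖x - y‖) + (‖f q x t - f q y t‖ / ‖x - y‖) * ‖g q y t‖ := by
      rw [mul_div_assoc', div_mul_eq_mul_div, ← add_div, ← norm_mul, ← norm_mul]
      gcongr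
      refine le_trans (le_of_eq ?_) (norm_add_le _ _)
      congr 1; ring
    refine (ENNReal.ofReal_le_ofReal r).trans ?_
    rw [ENNReal.ofReal_add (by positivity) (by positivity), ENNReal.ofReal_mul (by positivity),
      ENNReal.ofReal_mul (by positivity), ofReal_norm, ofReal_norm]
    exact add_le_add (mul_le_mul' (le_supT f t q hx) (le_semT g t q hx hy hxy))
      (mul_le_mul' (le_semT f t q hx hy hxy) (le_supT g t q hy))
  have h2 : supT A (fun q p t => f q p t * g q p t) t ≤ supT A f t * supT A g t := by
    refine iSup_le fun q => iSup_le fun p => iSup_le fun hp => ?_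
    rw [nnnorm_mul, ENNReal.coe_mul]
    exact mul_le_mul' (le_supT f t q hp) (le_supT g t q hp)
  rw [lipT_eq, lipT_eq, lipT_eq]
  calc _ ≤ (supT A f t * semT A g t + semT A f t * supT A g t) + supT A f t * supT A g t := add_le_add h1 h2
    _ ≤ ((supT A f t * semT A g t + semT A f t * supT A g t) + supT A f t * supT A g t)
        + supT A f t * supT A g t := le_self_add
    _ = _ := by ring

/-- **Product estimate for the weighted Lipschitz norms (Proposition 3.3.c).** -/
theorem wnormD_mul
    (n : ℕ) (σ : ℝ) (hσ : 1 ≤ σ) :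
    ∃ C : ℝ, 0 < C ∧
    ∀ (A : Set (E n)) (l m : ℝ) (f g : E n → E n → ℝ → ℝ),
      IsClosed A →
      (l = 0 ∨ 1 ≤ l) → (m = 0 ∨ 1 ≤ m) →
      MemD σ A f → MemD σ A g →
      wnormD σ (l + m) A (fun q p t => f q p t * g q p t)
        ≤ ENNReal.ofReal C *
          (wnormD 0 l A f * wnormD σ m A g + wnormD σ l A f * wnormD 0 m A g) := by
  obtain ⟨K, hK, H⟩ := holder_mul n σ hσ
  refine ⟨K + 2, by linarith, fun A l m f g _ hl hm hf hg => ?_⟩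
  set R := wnormD 0 l A f * wnormD σ m A g + wnormD σ l A f * wnormD 0 m A g with hR
  rw [ENNReal.ofReal_add hK.le (by norm_num), add_mul]
  conv_lhs => unfold wnormD
  refine add_le_add ?_ ?_
  · refine iSup_le fun p => iSup_le fun hp => iSup_le fun t => ?_
    have h1 := H _ _ (hf.2.2 p hp t) (hg.2.2 p hp t)
    have h2 : ENNReal.ofReal (w1 (l + m) t) ≤ ENNReal.ofReal (w1 l t) * ENNReal.ofReal (w1 m t) := by
      rw [← ENNReal.ofReal_mul (w1_nonneg l t)]
      exact ENNReal.ofReal_le_ofReal (w1_mul hl hm t)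
    refine (mul_le_mul' h1 h2).trans ?_
    rw [mul_assoc]
    gcongr
    rw [add_mul, mul_mul_mul_comm, mul_mul_mul_comm (holderNormOn σ univ fun q => f q p t)]
    exact add_le_add
      (mul_le_mul' (holder_le_wnormD 0 l A f hp t) (holder_le_wnormD σ m A g hp t))
      (mul_le_mul' (holder_le_wnormD σ l A f hp t) (holder_le_wnormD 0 m A g hp t))
  · refine iSup_le fun t => ?_
    refine (mul_le_mul_left (lipT_mul A f g t) _).trans ?_
    have h1 : ENNReal.ofReal (w2 (l + m) t) ≤
        ENNReal.ofReal 2 * (ENNReal.ofReal (w1 l t) * ENNReal.ofReal (w2 m t)) := by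
      rw [← ENNReal.ofReal_mul (w1_nonneg l t), ← ENNReal.ofReal_mul (by norm_num)]
      exact ENNReal.ofReal_le_ofReal (w2_mul hl hm t)
    have h2 : ENNReal.ofReal (w2 (l + m) t) ≤
        ENNReal.ofReal 2 * (ENNReal.ofReal (w2 l t) * ENNReal.ofReal (w1 m t)) := by
      rw [← ENNReal.ofReal_mul (w2_nonneg l t), ← ENNReal.ofReal_mul (by norm_num), add_comm,
        mul_comm (w2 l t)]
      exact ENNReal.ofReal_le_ofReal (w2_mul hm hl t)
    rw [add_mul, hR, mul_add]
    refine add_le_add ?_ ?_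
    · refine (mul_le_mul' le_rfl h1).trans ?_
      rw [mul_left_comm, mul_mul_mul_comm]
      exact mul_le_mul' le_rfl (mul_le_mul' (supT_le_wnormD 0 l A f t) (lipT_le_wnormD σ m A g t))
    · refine (mul_le_mul' le_rfl h2).trans ?_
      rw [mul_left_comm, mul_mul_mul_comm]
      exact mul_le_mul' le_rfl (mul_le_mul' (lipT_le_wnormD σ l A f t) (supT_le_wnormD 0 m A g t))

end Bias
end
end

section
/- Let σ ≥ 1, let A ⊂ ℝⁿ be a closed set, and let l, m ≥ 1 (the statement also holds when l = m = 0 or when exactly one of l, m is 0). Let f ∈ D_σ and let g ∈ D_σ be ℝⁿ-valued such that g̃(q,p,t) = (g(q,p,t), p, t) maps 𝕋ⁿ × A × ℝ into 𝕋ⁿ × A × ℝ. Then f ∘ g̃ ∈ D_σ and |f ∘ g̃|_{σ,l+m,L(A)} ≤ C(σ) (|f|_{σ,l,L(A)} |g|_{1,m,L(A)}^σ + |f|_{1,l,L(A)} |g|_{σ,m,L(A)} + |f|_{0,l+m,L(A)}) for a constant C(σ) depending only on n and σ. -/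
open scoped ENNReal NNReal Topology
open Filter Metric Set MeasureTheory

noncomputable section

namespace Bias

variable {n : ℕ}

variable {E' F : Type*} [NormedAddCommGroup E'] [NormedSpace ℝ E']
  [NormedAddCommGroup F] [NormedSpace ℝ F]

section Aux

variable {U V W : Type*} [NormedAddCommGroup U] [NormedSpace ℝ U]
  [NormedAddCommGroup V] [NormedSpace ℝ V] [NormedAddCommGroup W] [NormedSpace ℝ W]

lemma aux_sub (j : ℕ) (u : U → V) (x y : U) :
    ‖fderiv ℝ (iteratedFDeriv ℝ j u) x - fderiv ℝ (iteratedFDeriv ℝ j u) y‖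
      = ‖iteratedFDeriv ℝ (j+1) u x - iteratedFDeriv ℝ (j+1) u y‖ := by
  have := (continuousMultilinearCurryLeftEquiv ℝ (fun _ : Fin (j+1) => U) V).symm.norm_map
    (fderiv ℝ (iteratedFDeriv ℝ j u) x - fderiv ℝ (iteratedFDeriv ℝ j u) y)
  rw [LinearIsometryEquiv.map_sub] at this
  exact this.symm

lemma aux_diff {k j : ℕ} (hjk : j < k) {u : U → V} (hu : ContDiff ℝ k u) :
    Differentiable ℝ (iteratedFDeriv ℝ j u) :=
  hu.differentiable_iteratedFDeriv (by exact_mod_cast hjk)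

lemma aux_lip {k j : ℕ} (hjk : j < k) {u : U → V} (hu : ContDiff ℝ k u) {N : ℝ}
    (hN : ∀ x, ‖iteratedFDeriv ℝ (j+1) u x‖ ≤ N) (x y : U) :
    ‖iteratedFDeriv ℝ j u x - iteratedFDeriv ℝ j u y‖ ≤ N * ‖x - y‖ := by
  refine Convex.norm_image_sub_le_of_norm_fderiv_le (𝕜 := ℝ) (s := univ)
    (fun z _ => aux_diff hjk hu z) (fun z _ => ?_) convex_univ (mem_univ _) (mem_univ _)
  rw [norm_fderiv_iteratedFDeriv]
  exact hN z

/-- basic step -/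
lemma aux_step {k j : ℕ} (hjk : j < k) {u : U → V} (hu : ContDiff ℝ k u) {A H α h : ℝ}
    (hH : 0 ≤ H) (hα : 0 < α) (hh : 0 < h)
    (hA : ∀ x, ‖iteratedFDeriv ℝ j u x‖ ≤ A)
    (hHol : ∀ x y, ‖iteratedFDeriv ℝ (j+1) u x - iteratedFDeriv ℝ (j+1) u y‖ ≤ H * ‖x - y‖ ^ α)
    (x : U) : ‖iteratedFDeriv ℝ (j+1) u x‖ ≤ 2 * A / h + h ^ α * H := by
  have hA0 : 0 ≤ A := (norm_nonneg _).trans (hA x)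
  rw [← norm_fderiv_iteratedFDeriv]
  refine ContinuousLinearMap.opNorm_le_of_unit_norm (by positivity) fun e he => ?_
  have hB : x + h • e ∈ closedBall x h := by
    simp [mem_closedBall, dist_eq_norm, norm_smul, he, abs_of_pos hh]
  have key := Convex.norm_image_sub_le_of_norm_fderiv_le' (𝕜 := ℝ) (s := closedBall x h)
    (f := iteratedFDeriv ℝ j u) (φ := fderiv ℝ (iteratedFDeriv ℝ j u) x) (C := H * h ^ α)
    (fun z _ => aux_diff hjk hu z) (fun z hz => by
      rw [aux_sub]
      refine (hHol z x).trans ?_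
      have : ‖z - x‖ ≤ h := by simpa [dist_eq_norm] using hz
      gcongr) (convex_closedBall x h) (mem_closedBall_self hh.le) hB
  simp only [add_sub_cancel_left, map_smul, norm_smul, he, mul_one, Real.norm_eq_abs,
    abs_of_pos hh] at key
  set T := fderiv ℝ (iteratedFDeriv ℝ j u) x e
  have h3 : ‖h • T‖ ≤ A + A + H * h ^ α * h := by
    calc ‖h • T‖ = ‖iteratedFDeriv ℝ j u (x + h • e) - iteratedFDeriv ℝ j u x
          - (iteratedFDeriv ℝ j u (x + h • e) - iteratedFDeriv ℝ j u x - h • T)‖ := by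
            congr 1; abel
      _ ≤ _ := (norm_sub_le _ _).trans (add_le_add ((norm_sub_le _ _).trans
          (add_le_add (hA _) (hA _))) key)
  rw [norm_smul, Real.norm_eq_abs, abs_of_pos hh] at h3
  have : ‖T‖ ≤ (A + A + H * h ^ α * h) / h := by
    rw [le_div_iff₀ hh]; linarith
  refine this.trans (le_of_eq ?_)
  field_simp
  ring

lemma aux_half {ι : Type*} [Nonempty ι] {φ : ι → ℝ} {N₀ B : ℝ} (hN : ∀ x, φ x ≤ N₀)
    (h : ∀ N, (∀ x, φ x ≤ N) → ∀ x, φ x ≤ N / 2 + B) (x : ι) : φ x ≤ 2 * B := by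
  have hb : BddAbove (range φ) := ⟨N₀, by rintro _ ⟨y, rfl⟩; exact hN y⟩
  have h1 : ∀ y, φ y ≤ ⨆ z, φ z := fun y => le_ciSup hb y
  have h2 := ciSup_le (h _ h1)
  linarith [h1 x]

universe u1 u2

/-- interpolation -/
lemma aux_interp (s r : ℕ) : ∀ α : ℝ, 0 < α → ∀ ε : ℝ, 0 < ε → ∃ C : ℝ, 0 ≤ C ∧
    ∀ {U : Type u1} {V : Type u2} [NormedAddCommGroup U] [NormedSpace ℝ U]
      [NormedAddCommGroup V] [NormedSpace ℝ V] (u : U → V) (M H : ℝ), 0 ≤ H →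
      ContDiff ℝ (s + r : ℕ) u →
      (∀ i, s ≤ i → i ≤ s + r → ∃ N, ∀ x, ‖iteratedFDeriv ℝ i u x‖ ≤ N) →
      (∀ x, ‖iteratedFDeriv ℝ s u x‖ ≤ M) →
      (∀ x y, ‖iteratedFDeriv ℝ (s + r) u x - iteratedFDeriv ℝ (s + r) u y‖ ≤ H * ‖x - y‖ ^ α) →
      ∀ i, s ≤ i → i ≤ s + r → ∀ x, ‖iteratedFDeriv ℝ i u x‖ ≤ C * M + ε * H := by
  induction r with
  | zero =>
    intro α hα ε hε
    refine ⟨1, zero_le_one, ?_⟩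
    intro U V _ _ _ _ u M H hH hu hb hM hHol i hi hi' x
    obtain rfl : i = s := by omega
    have := hM x
    have : 0 ≤ ε * H := by positivity
    linarith [hM x]
  | succ r ih =>
    intro α hα ε hε
    obtain ⟨h, hh, hh1, hhα⟩ : ∃ h : ℝ, 0 < h ∧ h ≤ 1 ∧ 2 * h ^ α ≤ ε := by
      refine ⟨min 1 ((ε/2) ^ (1/α)), by positivity, min_le_left _ _, ?_⟩
      have : (min 1 ((ε/2) ^ (1/α))) ^ α ≤ ((ε/2) ^ (1/α)) ^ α := by
        gcongr
        exact min_le_right _ _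
      rw [← Real.rpow_mul (by positivity), one_div_mul_cancel hα.ne', Real.rpow_one] at this
      linarith
    obtain ⟨C', hC', IH⟩ := ih 1 one_pos (h/4) (by positivity)
    refine ⟨C' + 4 * C' / h, by positivity, ?_⟩
    intro U V _ _ _ _ u M H hH hu hb hM hHol
    have hM0 : 0 ≤ M := (norm_nonneg _).trans (hM 0)
    have low : ∀ N, (∀ x, ‖iteratedFDeriv ℝ (s + r + 1) u x‖ ≤ N) →
        ∀ i, s ≤ i → i ≤ s + r → ∀ x, ‖iteratedFDeriv ℝ i u x‖ ≤ C' * M + h/4 * N := by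
      intro N hN
      refine IH u M N ((norm_nonneg _).trans (hN 0))
        (hu.of_le (by exact_mod_cast (by omega)))
        (fun i h1 h2 => hb i h1 (by omega)) hM ?_
      intro x y
      rw [Real.rpow_one]
      exact aux_lip (k := s + (r+1)) (by omega) hu hN x y
    obtain ⟨N₀, hN₀⟩ := hb (s + r + 1) (by omega) (by omega)
    have top : ∀ x, ‖iteratedFDeriv ℝ (s + r + 1) u x‖ ≤ 2 * (2 * C' * M / h + h ^ α * H) := by
      refine aux_half hN₀ fun N hN x => ?_
      have := aux_step (k := s + (r+1)) (j := s + r) (by omega) hu hH hα hh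
        (low N hN (s+r) (by omega) le_rfl) hHol x
      refine this.trans (le_of_eq ?_)
      field_simp
      ring
    intro i hi hi' x
    have e0 : 2 * (2 * C' * M / h + h ^ α * H) = 4 * C' / h * M + 2 * h ^ α * H := by ring
    have e1 : 2 * h ^ α * H ≤ ε * H := by gcongr
    have e2 : 0 ≤ C' * M := by positivity
    have e3 : 0 ≤ 4 * C' / h * M + 2 * h ^ α * H := by positivity
    rcases Nat.lt_or_ge i (s + r + 1) with h1 | h1
    · have := low _ top i hi (by omega) x
      rw [e0] at this
      nlinarith
    · obtain rfl : i = s + r + 1 := by omega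
      have := top x
      rw [e0] at this
      linarith

lemma aux_lip0 {K : ℕ} (hK : 1 ≤ K) {u : U → V} (hu : ContDiff ℝ K u) {N : ℝ}
    (hN : ∀ x, ‖iteratedFDeriv ℝ 1 u x‖ ≤ N) (x y : U) : ‖u x - u y‖ ≤ N * ‖x - y‖ := by
  refine Convex.norm_image_sub_le_of_norm_fderiv_le (𝕜 := ℝ) (s := univ)
    (fun z _ => (hu.differentiable (by exact_mod_cast (by omega))) z) (fun z _ => ?_)
    convex_univ (mem_univ _) (mem_univ _)
  have := norm_iteratedFDeriv_fderiv (𝕜 := ℝ) (n := 0) (f := u) (x := z)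
  rw [norm_iteratedFDeriv_zero] at this
  rw [this]
  exact hN z

lemma aux_mid {K : ℕ} {α M : ℝ} (hα : 0 < α) (hα1 : α ≤ 1) {u : U → V}
    (hu : ContDiff ℝ K u)
    (hM : ∀ i, 1 ≤ i → i ≤ K → ∀ x, ‖iteratedFDeriv ℝ i u x‖ ≤ M)
    (hH : ∀ x y, ‖iteratedFDeriv ℝ K u x - iteratedFDeriv ℝ K u y‖ ≤ M * ‖x - y‖ ^ α)
    (i : ℕ) (hi : 1 ≤ i) (hi' : i ≤ K) (x y : U) :
    ‖iteratedFDeriv ℝ i u x - iteratedFDeriv ℝ i u y‖ ≤ 2 * M * ‖x - y‖ ^ α := by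
  have hM0 : 0 ≤ M := (norm_nonneg _).trans (hM i hi hi' x)
  have hp : 0 ≤ M * ‖x - y‖ ^ α := by positivity
  rcases Nat.lt_or_ge i K with h1 | h1
  · rcases le_total ‖x - y‖ 1 with h2 | h2
    · have h3 : ‖x - y‖ ≤ ‖x - y‖ ^ α := by
        have := Real.rpow_le_rpow_of_exponent_ge' (norm_nonneg (x - y)) h2 hα.le hα1
        rwa [Real.rpow_one] at this
      have h4 := aux_lip h1 hu (hM (i+1) (by omega) h1) x y
      have h5 : M * ‖x - y‖ ≤ M * ‖x - y‖ ^ α := by gcongr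
      linarith
    · have h3 : 1 ≤ ‖x - y‖ ^ α := Real.one_le_rpow h2 hα.le
      have h4 := (norm_sub_le (iteratedFDeriv ℝ i u x) (iteratedFDeriv ℝ i u y)).trans
        (add_le_add (hM i hi hi' x) (hM i hi hi' y))
      have h5 : M * 1 ≤ M * ‖x - y‖ ^ α := by gcongr
      linarith
  · obtain rfl : i = K := by omega
    linarith [hH x y]

def compC (K : ℕ) (M : ℝ) : ℝ :=
  ∑ c : OrderedFinpartition K,
    (M * c.length * M ^ (c.length - 1) * (2 * M) + 2 * M * M * M ^ c.length)

lemma aux_comp_unit {K : ℕ} (hK : 1 ≤ K) {α M : ℝ} (hα : 0 < α) (hα1 : α ≤ 1) (hM1 : 1 ≤ M)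
    {F : V → W} {G : U → V} (hF : ContDiff ℝ K F) (hG : ContDiff ℝ K G)
    (hFM : ∀ i, 1 ≤ i → i ≤ K → ∀ x, ‖iteratedFDeriv ℝ i F x‖ ≤ M)
    (hFH : ∀ x y, ‖iteratedFDeriv ℝ K F x - iteratedFDeriv ℝ K F y‖ ≤ M * ‖x - y‖ ^ α)
    (hGM : ∀ i, 1 ≤ i → i ≤ K → ∀ x, ‖iteratedFDeriv ℝ i G x‖ ≤ M)
    (hGH : ∀ x y, ‖iteratedFDeriv ℝ K G x - iteratedFDeriv ℝ K G y‖ ≤ M * ‖x - y‖ ^ α)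
    (x y : U) :
    ‖iteratedFDeriv ℝ K (F ∘ G) x - iteratedFDeriv ℝ K (F ∘ G) y‖
      ≤ compC K M * ‖x - y‖ ^ α := by
  have hM0 : 0 ≤ M := by linarith
  have hd : 0 ≤ ‖x - y‖ ^ α := by positivity
  rw [iteratedFDeriv_comp hF.contDiffAt hG.contDiffAt le_rfl,
    iteratedFDeriv_comp hF.contDiffAt hG.contDiffAt le_rfl]
  simp only [FormalMultilinearSeries.taylorComp, ← Finset.sum_sub_distrib]
  rw [compC, Finset.sum_mul]
  refine (norm_sum_le _ _).trans (Finset.sum_le_sum fun c _ => ?_)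
  refine (c.norm_compAlongOrderedFinpartition_sub_compAlongOrderedFinpartition_le _ _ _ _).trans ?_
  have hl : 1 ≤ c.length := c.length_pos hK
  have hl' : c.length ≤ K := c.length_le
  have g1 : ∀ z, ‖(fun m => ftaylorSeries ℝ G z (c.partSize m))‖ ≤ M := fun z =>
    (pi_norm_le_iff_of_nonneg hM0).2 fun m => hGM _ (c.partSize_pos m) (c.partSize_le m) z
  have g2 : ‖(fun m => ftaylorSeries ℝ G x (c.partSize m)) -
      (fun m => ftaylorSeries ℝ G y (c.partSize m))‖ ≤ 2 * M * ‖x - y‖ ^ α :=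
    (pi_norm_le_iff_of_nonneg (by positivity)).2 fun m =>
      aux_mid hα hα1 hG hGM hGH _ (c.partSize_pos m) (c.partSize_le m) x y
  have f1 : ‖ftaylorSeries ℝ F (G x) c.length‖ ≤ M := hFM _ hl hl' _
  have f2 : ‖ftaylorSeries ℝ F (G x) c.length - ftaylorSeries ℝ F (G y) c.length‖
      ≤ 2 * M * M * ‖x - y‖ ^ α := by
    refine (aux_mid hα hα1 hF hFM hFH _ hl hl' (G x) (G y)).trans ?_
    rw [mul_assoc (2 * M)]
    gcongr
    calc ‖G x - G y‖ ^ α ≤ (M * ‖x - y‖) ^ α := by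
          gcongr
          exact aux_lip0 hK hG (hGM 1 le_rfl hK) x y
      _ = M ^ α * ‖x - y‖ ^ α := Real.mul_rpow hM0 (norm_nonneg _)
      _ ≤ M * ‖x - y‖ ^ α := by
          gcongr
          simpa using Real.rpow_le_rpow_of_exponent_le hM1 hα1
  have g3 : ∏ m, ‖ftaylorSeries ℝ G y (c.partSize m)‖ ≤ M ^ c.length := by
    calc _ ≤ ∏ m : Fin c.length, M := Finset.prod_le_prod (fun _ _ => norm_nonneg _)
          fun m _ => hGM _ (c.partSize_pos m) (c.partSize_le m) y
      _ = _ := by simp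
  have g4 : max ‖(fun m => ftaylorSeries ℝ G x (c.partSize m))‖
      ‖(fun m => ftaylorSeries ℝ G y (c.partSize m))‖ ≤ M := max_le (g1 x) (g1 y)
  calc _ ≤ M * c.length * M ^ (c.length - 1) * (2 * M * ‖x - y‖ ^ α)
        + (2 * M * M * ‖x - y‖ ^ α) * M ^ c.length := by
        gcongr
    _ = _ := by ring

lemma aux_scale {i : ℕ} {u : U → V} (hu : ContDiff ℝ i u) (c r : ℝ) (x : U) :
    iteratedFDeriv ℝ i (fun z => c • u (r • z)) x = (c * r ^ i) • iteratedFDeriv ℝ i u (r • x) := by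
  have h1 : ContDiff ℝ i (fun z => u (r • z)) := hu.comp (contDiff_const_smul r)
  rw [iteratedFDeriv_const_smul_apply' h1.contDiffAt, iteratedFDeriv_comp_const_smul r hu,
    smul_smul]

lemma aux_scale_hol {K : ℕ} {u : U → V} (hu : ContDiff ℝ K u) {c r α P : ℝ} (hc : 0 < c)
    (hr : 0 < r)
    (hP : ∀ x y, ‖iteratedFDeriv ℝ K u x - iteratedFDeriv ℝ K u y‖ ≤ P * ‖x - y‖ ^ α) (x y : U) :
    ‖iteratedFDeriv ℝ K (fun z => c • u (r • z)) x - iteratedFDeriv ℝ K (fun z => c • u (r • z)) y‖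
      ≤ (c * r ^ ((K : ℝ) + α) * P) * ‖x - y‖ ^ α := by
  rw [aux_scale hu, aux_scale hu, ← smul_sub, norm_smul, Real.norm_of_nonneg (by positivity)]
  have := hP (r • x) (r • y)
  rw [← smul_sub, norm_smul, Real.norm_of_nonneg hr.le, Real.mul_rpow hr.le (norm_nonneg _)] at this
  rw [Real.rpow_add hr, Real.rpow_natCast]
  calc _ ≤ c * r ^ K * (P * (r ^ α * ‖x - y‖ ^ α)) := by gcongr
    _ = _ := by ring

lemma aux_scale_bd {i : ℕ} {u : U → V} (hu : ContDiff ℝ i u) {c r N : ℝ} (hc : 0 < c)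
    (hr : 0 < r) (hN : ∀ x, ‖iteratedFDeriv ℝ i u x‖ ≤ N) (x : U) :
    ‖iteratedFDeriv ℝ i (fun z => c • u (r • z)) x‖ ≤ c * r ^ i * N := by
  rw [aux_scale hu, norm_smul, Real.norm_of_nonneg (by positivity)]
  gcongr
  exact hN _

lemma aux_comp {K : ℕ} (hK : 1 ≤ K) {α : ℝ} (hα : 0 < α) (hα1 : α ≤ 1) : ∃ C : ℝ, 0 ≤ C ∧
    ∀ {U V : Type u1} {W : Type u1} [NormedAddCommGroup U] [NormedSpace ℝ U]
      [NormedAddCommGroup V] [NormedSpace ℝ V] [NormedAddCommGroup W] [NormedSpace ℝ W]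
      (F : V → W) (G : U → V) (a b P Q : ℝ), 0 < a → 0 < b → 0 < P → 0 < Q →
      ContDiff ℝ K F → ContDiff ℝ K G →
      (∀ i, 1 ≤ i → i ≤ K → ∃ N, ∀ x, ‖iteratedFDeriv ℝ i F x‖ ≤ N) →
      (∀ i, 1 ≤ i → i ≤ K → ∃ N, ∀ x, ‖iteratedFDeriv ℝ i G x‖ ≤ N) →
      (∀ x, ‖iteratedFDeriv ℝ 1 F x‖ ≤ a) → (∀ x, ‖iteratedFDeriv ℝ 1 G x‖ ≤ b) →
      (∀ x y, ‖iteratedFDeriv ℝ K F x - iteratedFDeriv ℝ K F y‖ ≤ P * ‖x - y‖ ^ α) →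
      (∀ x y, ‖iteratedFDeriv ℝ K G x - iteratedFDeriv ℝ K G y‖ ≤ Q * ‖x - y‖ ^ α) →
      ∀ x y, ‖iteratedFDeriv ℝ K (F ∘ G) x - iteratedFDeriv ℝ K (F ∘ G) y‖
        ≤ (C * (P * b ^ ((K : ℝ) + α) + a * Q)) * ‖x - y‖ ^ α := by
  obtain ⟨r, rfl⟩ : ∃ r, K = 1 + r := ⟨K - 1, by omega⟩
  obtain ⟨C₁, hC₁, int⟩ := aux_interp.{u1, u1} 1 r α hα 1 one_pos
  have hcc : 0 ≤ compC (1 + r) (C₁ + 1) := by unfold compC; positivity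
  refine ⟨compC (1 + r) (C₁ + 1), hcc, ?_⟩
  intro U V W _ _ _ _ _ _ F G a b P Q ha hb hP hQ hF hG hFb hGb hFa hGb1 hFP hGQ
  set K := 1 + r with hKr
  set σ : ℝ := (K : ℝ) + α with hσ
  have hK1 : (1 : ℝ) ≤ K := by exact_mod_cast hK
  have hσ1 : 0 < σ - 1 := by linarith
  set S := P * b ^ σ + a * Q with hS
  have hX : 0 < P * b ^ σ := by positivity
  have hY : 0 < a * Q := by positivity
  have hS0 : 0 < S := by positivity
  set ρ : ℝ := (a * b / S) ^ (1 / (σ - 1)) with hρ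
  have hρ0 : 0 < ρ := by positivity
  have hρσ : ρ ^ σ = ρ * (a * b / S) := by
    have h1 : ρ ^ (σ - 1) = a * b / S := by
      rw [hρ, ← Real.rpow_mul (by positivity), one_div_mul_cancel hσ1.ne', Real.rpow_one]
    have h2 : σ = 1 + (σ - 1) := by ring
    rw [h2, Real.rpow_add hρ0, Real.rpow_one, h1]
  set cF := (a * b * ρ)⁻¹ with hcF
  set cG := (b * ρ)⁻¹ with hcG
  have hcF0 : 0 < cF := by positivity
  have hcG0 : 0 < cG := by positivity
  have hbρ : 0 < b * ρ := by positivity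
  set F' : V → W := fun z => cF • F ((b * ρ) • z) with hF'
  set G' : U → V := fun z => cG • G (ρ • z) with hG'
  have hF'c : ContDiff ℝ K F' := (hF.comp (contDiff_const_smul _)).const_smul _
  have hG'c : ContDiff ℝ K G' := (hG.comp (contDiff_const_smul _)).const_smul _
  have F1 : ∀ x, ‖iteratedFDeriv ℝ 1 F' x‖ ≤ 1 := fun x => by
    refine (aux_scale_bd (hF.of_le (by exact_mod_cast hK)) hcF0 hbρ hFa x).trans (le_of_eq ?_)
    rw [hcF]; field_simp
  have G1 : ∀ x, ‖iteratedFDeriv ℝ 1 G' x‖ ≤ 1 := fun x => by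
    refine (aux_scale_bd (hG.of_le (by exact_mod_cast hK)) hcG0 hρ0 hGb1 x).trans (le_of_eq ?_)
    rw [hcG]; field_simp
  have FH : ∀ x y, ‖iteratedFDeriv ℝ K F' x - iteratedFDeriv ℝ K F' y‖ ≤ 1 * ‖x - y‖ ^ α := by
    intro x y
    refine (aux_scale_hol hF hcF0 hbρ hFP x y).trans ?_
    gcongr
    rw [← hσ, Real.mul_rpow hb.le hρ0.le, hρσ, hcF]
    have : (a * b * ρ)⁻¹ * (b ^ σ * (ρ * (a * b / S))) * P = P * b ^ σ / S := by
      field_simp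
    rw [this, div_le_one hS0]
    linarith
  have GH : ∀ x y, ‖iteratedFDeriv ℝ K G' x - iteratedFDeriv ℝ K G' y‖ ≤ 1 * ‖x - y‖ ^ α := by
    intro x y
    refine (aux_scale_hol hG hcG0 hρ0 hGQ x y).trans ?_
    gcongr
    rw [← hσ, hρσ, hcG]
    have : (b * ρ)⁻¹ * (ρ * (a * b / S)) * Q = a * Q / S := by
      field_simp
    rw [this, div_le_one hS0]
    linarith
  have FB := int F' 1 1 zero_le_one hF'c (fun i h1 h2 => by
    obtain ⟨N, hN⟩ := hFb i h1 h2
    exact ⟨_, aux_scale_bd (hF.of_le (by exact_mod_cast h2)) hcF0 hbρ hN⟩) F1 FH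
  have GB := int G' 1 1 zero_le_one hG'c (fun i h1 h2 => by
    obtain ⟨N, hN⟩ := hGb i h1 h2
    exact ⟨_, aux_scale_bd (hG.of_le (by exact_mod_cast h2)) hcG0 hρ0 hN⟩) G1 GH
  simp only [mul_one] at FB GB
  have hM1 : 1 ≤ C₁ + 1 := by linarith
  have hunit := aux_comp_unit hK hα hα1 hM1 hF'c hG'c FB
    (fun x y => (FH x y).trans (by gcongr)) GB (fun x y => (GH x y).trans (by gcongr))
  have hFG : F ∘ G = fun z => cF⁻¹ • (F' ∘ G') (ρ⁻¹ • z) := by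
    funext z
    simp only [Function.comp_apply, hF', hG', smul_smul]
    rw [inv_mul_cancel₀ hcF0.ne', mul_inv_cancel₀ hρ0.ne', hcG, mul_inv_cancel₀ hbρ.ne']
    simp
  intro x y
  rw [hFG]
  refine (aux_scale_hol (hF'c.comp hG'c) (inv_pos.2 hcF0) (inv_pos.2 hρ0) hunit x y).trans
    (le_of_eq ?_)
  congr 1
  rw [← hσ, Real.inv_rpow hρ0.le, hρσ, hcF]
  field_simp

lemma aux_bdd {k : ℕ} {F : V → W} {G : U → V} {P Q : ℝ} (hF : ContDiff ℝ k F)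
    (hG : ContDiff ℝ k G) (hQ : 0 ≤ Q)
    (hFP : ∀ i, i ≤ k → ∀ x, ‖iteratedFDeriv ℝ i F x‖ ≤ P)
    (hGQ : ∀ i, i ≤ k → ∀ x, ‖iteratedFDeriv ℝ i G x‖ ≤ Q) (i : ℕ) (hi : i ≤ k) :
    ∃ N, ∀ x, ‖iteratedFDeriv ℝ i (F ∘ G) x‖ ≤ N := by
  refine ⟨i.factorial * P * (Q + 1) ^ i, fun x => ?_⟩
  refine norm_iteratedFDeriv_comp_le hF hG (by exact_mod_cast hi) x
    (fun j hj => hFP j (hj.trans hi) _) (fun j hj hj' => ?_)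
  refine (hGQ j (hj'.trans hi) x).trans ?_
  have : (Q + 1) ^ 1 ≤ (Q + 1) ^ j := pow_le_pow_right₀ (by linarith) hj
  linarith

lemma aux_interp_comp {K : ℕ} (hK : 1 ≤ K) {α : ℝ} (hα : 0 < α) (hα1 : α ≤ 1) :
    ∃ C : ℝ, 0 ≤ C ∧
    ∀ {U V : Type u1} {W : Type u1} [NormedAddCommGroup U] [NormedSpace ℝ U]
      [NormedAddCommGroup V] [NormedSpace ℝ V] [NormedAddCommGroup W] [NormedSpace ℝ W]
      (F : V → W) (G : U → V) (a b P Q M : ℝ), 0 < a → 0 < b → 0 < P → 0 < Q →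
      ContDiff ℝ K F → ContDiff ℝ K G →
      (∀ i, i ≤ K → ∀ x, ‖iteratedFDeriv ℝ i F x‖ ≤ P) →
      (∀ i, i ≤ K → ∀ x, ‖iteratedFDeriv ℝ i G x‖ ≤ Q) →
      (∀ x, ‖F x‖ ≤ M) →
      (∀ x, ‖iteratedFDeriv ℝ 1 F x‖ ≤ a) → (∀ x, ‖iteratedFDeriv ℝ 1 G x‖ ≤ b) →
      (∀ x y, ‖iteratedFDeriv ℝ K F x - iteratedFDeriv ℝ K F y‖ ≤ P * ‖x - y‖ ^ α) →
      (∀ x y, ‖iteratedFDeriv ℝ K G x - iteratedFDeriv ℝ K G y‖ ≤ Q * ‖x - y‖ ^ α) →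
      (∀ i, i ≤ K → ∀ x, ‖iteratedFDeriv ℝ i (F ∘ G) x‖
        ≤ C * (P * b ^ ((K : ℝ) + α) + a * Q + M)) ∧
      ∀ x y, ‖iteratedFDeriv ℝ K (F ∘ G) x - iteratedFDeriv ℝ K (F ∘ G) y‖
        ≤ (C * (P * b ^ ((K : ℝ) + α) + a * Q + M)) * ‖x - y‖ ^ α := by
  obtain ⟨C₁, hC₁, comp⟩ := aux_comp.{u1} hK hα hα1
  obtain ⟨C₂, hC₂, int⟩ := aux_interp.{u1, u1} 0 K α hα 1 one_pos
  refine ⟨C₁ + C₂, by positivity, ?_⟩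
  intro U V W _ _ _ _ _ _ F G a b P Q M ha hb hP hQ hF hG hFP hGQ hM hFa hGb hFH hGH
  have hol := comp F G a b P Q ha hb hP hQ hF hG (fun i _ h => ⟨P, hFP i h⟩)
    (fun i _ h => ⟨Q, hGQ i h⟩) hFa hGb hFH hGH
  have hM0 : 0 ≤ M := (norm_nonneg _).trans (hM 0)
  have hX : 0 ≤ P * b ^ ((K : ℝ) + α) + a * Q := by positivity
  set X := P * b ^ ((K : ℝ) + α) + a * Q
  have p1 : 0 ≤ C₁ * M := by positivity
  have p2 : 0 ≤ C₂ * X := by positivity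
  have p3 : 0 ≤ C₂ * M := by positivity
  have e : (C₁ + C₂) * (X + M) = C₁ * X + C₁ * M + C₂ * X + C₂ * M := by ring
  constructor
  · intro i hi x
    have := int (F ∘ G) M (C₁ * X) (by positivity)
      (by rw [Nat.zero_add]; exact hF.comp hG)
      (fun i _ hi => aux_bdd hF hG hQ.le hFP hGQ i (by omega))
      (fun x => by rw [norm_iteratedFDeriv_zero]; exact hM _)
      (by rw [Nat.zero_add]; exact hol) i (Nat.zero_le _) (by omega) x
    linarith
  · intro x y
    refine (hol x y).trans ?_
    exact mul_le_mul_of_nonneg_right (by linarith) (by positivity)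

lemma aux_real (σ : ℝ) (hσ : 1 ≤ σ) :
    ∃ C : ℝ, 0 ≤ C ∧
    ∀ {U V : Type u1} {W : Type u1} [NormedAddCommGroup U] [NormedSpace ℝ U]
      [NormedAddCommGroup V] [NormedSpace ℝ V] [NormedAddCommGroup W] [NormedSpace ℝ W]
      (F : V → W) (G : U → V) (a b P Q M : ℝ), 0 < a → 0 < b → 0 < P → 0 < Q →
      ContDiff ℝ ⌊σ⌋₊ F → ContDiff ℝ ⌊σ⌋₊ G →
      (∀ i, i ≤ ⌊σ⌋₊ → ∀ x, ‖iteratedFDeriv ℝ i F x‖ ≤ P) →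
      (∀ i, i ≤ ⌊σ⌋₊ → ∀ x, ‖iteratedFDeriv ℝ i G x‖ ≤ Q) →
      (∀ x, ‖F x‖ ≤ M) →
      (∀ x, ‖iteratedFDeriv ℝ 1 F x‖ ≤ a) → (∀ x, ‖iteratedFDeriv ℝ 1 G x‖ ≤ b) →
      ((⌊σ⌋₊ : ℝ) ≠ σ → ∀ x y, ‖iteratedFDeriv ℝ ⌊σ⌋₊ F x - iteratedFDeriv ℝ ⌊σ⌋₊ F y‖
        ≤ P * ‖x - y‖ ^ (σ - (⌊σ⌋₊ : ℝ))) →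
      ((⌊σ⌋₊ : ℝ) ≠ σ → ∀ x y, ‖iteratedFDeriv ℝ ⌊σ⌋₊ G x - iteratedFDeriv ℝ ⌊σ⌋₊ G y‖
        ≤ Q * ‖x - y‖ ^ (σ - (⌊σ⌋₊ : ℝ))) →
      (∀ i, i ≤ ⌊σ⌋₊ → ∀ x, ‖iteratedFDeriv ℝ i (F ∘ G) x‖
        ≤ C * (P * b ^ σ + a * Q + M)) ∧
      ((⌊σ⌋₊ : ℝ) ≠ σ → ∀ x y,
        ‖iteratedFDeriv ℝ ⌊σ⌋₊ (F ∘ G) x - iteratedFDeriv ℝ ⌊σ⌋₊ (F ∘ G) y‖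
        ≤ (C * (P * b ^ σ + a * Q + M)) * ‖x - y‖ ^ (σ - (⌊σ⌋₊ : ℝ))) := by
  have hk : 1 ≤ ⌊σ⌋₊ := Nat.one_le_floor_iff _ |>.2 hσ
  by_cases hint : (⌊σ⌋₊ : ℝ) = σ
  · generalize hkk : ⌊σ⌋₊ = k at *
    subst hint
    obtain ⟨K, rfl⟩ : ∃ K, k = K + 1 := ⟨k - 1, by omega⟩
    -- helper: bound for top derivative from a Lipschitz bound
    rcases Nat.eq_zero_or_pos K with rfl | hK
    · refine ⟨1, zero_le_one, ?_⟩
      intro U V W _ _ _ _ _ _ F G a b P Q M ha hb hP hQ hF hG hFP hGQ hM hFa hGb hFH hGH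
      refine ⟨?_, fun h => absurd rfl h⟩
      have hM0 : 0 ≤ M := (norm_nonneg _).trans (hM 0)
      have hX : 0 ≤ P * b ^ ((0 + 1 : ℕ) : ℝ) := by positivity
      have hY : 0 ≤ a * Q := by positivity
      intro i hi x
      have : i = 0 ∨ i = 1 := by omega
      rcases this with rfl | rfl
      · rw [norm_iteratedFDeriv_zero]
        have := hM (G x)
        simp only [Function.comp_apply]
        linarith
      · have h1 : ‖iteratedFDeriv ℝ 1 (F ∘ G) x‖ ≤ a * Q := by
          rw [← norm_fderiv_iteratedFDeriv]
          refine norm_fderiv_le_of_lip' ℝ hY (Eventually.of_forall fun y => ?_)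
          simp only [iteratedFDeriv_zero_eq_comp, Function.comp_apply]
          rw [← LinearIsometryEquiv.map_sub, LinearIsometryEquiv.norm_map]
          refine (aux_lip0 le_rfl hF hFa _ _).trans ?_
          rw [mul_assoc]
          gcongr
          exact aux_lip0 le_rfl hG (hGQ 1 le_rfl) _ _
        linarith
    · obtain ⟨C, hC, main⟩ := aux_interp_comp.{u1} hK one_pos le_rfl
      refine ⟨C, hC, ?_⟩
      intro U V W _ _ _ _ _ _ F G a b P Q M ha hb hP hQ hF hG hFP hGQ hM hFa hGb hFH hGH
      refine ⟨?_, fun h => absurd rfl h⟩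
      have hF' : ContDiff ℝ K F := hF.of_le (by exact_mod_cast Nat.le_succ K)
      have hG' : ContDiff ℝ K G := hG.of_le (by exact_mod_cast Nat.le_succ K)
      obtain ⟨r1, r2⟩ := main F G a b P Q M ha hb hP hQ hF' hG' (fun i hi => hFP i (by omega))
        (fun i hi => hGQ i (by omega)) hM hFa hGb
        (fun x y => by rw [Real.rpow_one]; exact aux_lip (Nat.lt_succ_self K) hF (hFP _ le_rfl) x y)
        (fun x y => by rw [Real.rpow_one]; exact aux_lip (Nat.lt_succ_self K) hG (hGQ _ le_rfl) x y)
      have hM0 : 0 ≤ M := (norm_nonneg _).trans (hM 0)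
      have ecast : ((K + 1 : ℕ) : ℝ) = (K : ℝ) + 1 := by push_cast; ring
      rw [ecast]
      intro i hi x
      rcases Nat.lt_or_ge i (K+1) with h | h
      · exact r1 i (by omega) x
      · obtain rfl : i = K + 1 := by omega
        rw [← norm_fderiv_iteratedFDeriv]
        refine norm_fderiv_le_of_lip' ℝ (by positivity) (Eventually.of_forall fun y => ?_)
        have := r2 y x
        rwa [Real.rpow_one] at this
  · have h1 : (⌊σ⌋₊ : ℝ) < σ := lt_of_le_of_ne (Nat.floor_le (by linarith)) hint
    have h2 := Nat.lt_floor_add_one σ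
    obtain ⟨C, hC, main⟩ := aux_interp_comp.{u1} hk (α := σ - ⌊σ⌋₊) (by linarith) (by linarith)
    refine ⟨C, hC, ?_⟩
    intro U V W _ _ _ _ _ _ F G a b P Q M ha hb hP hQ hF hG hFP hGQ hM hFa hGb hFH hGH
    have := main F G a b P Q M ha hb hP hQ hF hG hFP hGQ hM hFa hGb (hFH hint) (hGH hint)
    rw [add_sub_cancel] at this
    exact ⟨this.1, fun _ => this.2⟩

lemma holder_ge {σ : ℝ} (F : U → V) {i : ℕ} (hi : i ≤ ⌊σ⌋₊) (x : U) :
    (‖iteratedFDeriv ℝ i F x‖₊ : ℝ≥0∞) ≤ holderNormOn σ univ F := by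
  refine le_trans ?_ le_self_add
  unfold cNormOn
  refine le_iSup_of_le ⟨i, by omega⟩ (le_iSup₂_of_le x (mem_univ _) ?_)
  rw [iteratedFDerivWithin_univ]

lemma holder_ge' {σ : ℝ} {F : U → V} (h : holderNormOn σ univ F ≠ ⊤) {i : ℕ} (hi : i ≤ ⌊σ⌋₊)
    (x : U) : ‖iteratedFDeriv ℝ i F x‖ ≤ (holderNormOn σ univ F).toReal := by
  have := ENNReal.toReal_mono h (holder_ge F hi x)
  simpa using this

lemma holder_ge_top {σ : ℝ} {F : U → V} (h : holderNormOn σ univ F ≠ ⊤)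
    (hs : (⌊σ⌋₊ : ℝ) ≠ σ) (x y : U) :
    ‖iteratedFDeriv ℝ ⌊σ⌋₊ F x - iteratedFDeriv ℝ ⌊σ⌋₊ F y‖
      ≤ (holderNormOn σ univ F).toReal * ‖x - y‖ ^ (σ - (⌊σ⌋₊ : ℝ)) := by
  rcases eq_or_ne x y with rfl | hxy
  · have : σ - (⌊σ⌋₊ : ℝ) ≠ 0 := fun h' => hs (by linarith)
    simp [Real.zero_rpow this]
  have hd : 0 < ‖x - y‖ := norm_pos_iff.2 (sub_ne_zero.2 hxy)
  rw [← div_le_iff₀ (by positivity)]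
  rw [← ENNReal.ofReal_le_iff_le_toReal h]
  unfold holderNormOn
  rw [if_neg hs]
  refine le_trans ?_ le_add_self
  refine le_iSup₂_of_le x (mem_univ _) (le_iSup₂_of_le y (mem_univ _) (le_iSup_of_le hxy ?_))
  rw [iteratedFDerivWithin_univ]

lemma holder_le {σ : ℝ} {F : U → V} {B : ℝ} (hB : 0 ≤ B)
    (h1 : ∀ i, i ≤ ⌊σ⌋₊ → ∀ x, ‖iteratedFDeriv ℝ i F x‖ ≤ B)
    (h2 : (⌊σ⌋₊ : ℝ) ≠ σ → ∀ x y, ‖iteratedFDeriv ℝ ⌊σ⌋₊ F x - iteratedFDeriv ℝ ⌊σ⌋₊ F y‖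
        ≤ B * ‖x - y‖ ^ (σ - (⌊σ⌋₊ : ℝ))) :
    holderNormOn σ univ F ≤ ENNReal.ofReal (2 * B) := by
  rw [two_mul, ENNReal.ofReal_add hB hB]
  unfold holderNormOn
  refine add_le_add ?_ ?_
  · unfold cNormOn
    refine iSup_le fun i => iSup₂_le fun x _ => ?_
    rw [iteratedFDerivWithin_univ]
    have := ENNReal.ofReal_le_ofReal (h1 i (by omega) x)
    rwa [ofReal_norm] at this
  · split_ifs with hs
    · exact zero_le
    · refine iSup₂_le fun x _ => iSup₂_le fun y _ => iSup_le fun hxy => ?_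
      have hd : 0 < ‖x - y‖ := norm_pos_iff.2 (sub_ne_zero.2 hxy)
      refine ENNReal.ofReal_le_ofReal ?_
      rw [div_le_iff₀ (by positivity), iteratedFDerivWithin_univ]
      exact h2 hs x y

lemma holder_const {σ : ℝ} (c : V) :
    holderNormOn σ univ (fun _ : U => c) ≤ ENNReal.ofReal (2 * ‖c‖) := by
  refine holder_le (norm_nonneg _) ?_ ?_
  · intro i _ x
    rcases Nat.eq_zero_or_pos i with rfl | hi
    · rw [norm_iteratedFDeriv_zero]
    · rw [iteratedFDeriv_const_of_ne hi.ne']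
      simp
  · intro _ x y
    rcases Nat.eq_zero_or_pos ⌊σ⌋₊ with h | hi
    · have : ∀ k, k = 0 → iteratedFDeriv ℝ k (fun _ : U => c) x
          = iteratedFDeriv ℝ k (fun _ : U => c) y := by
        rintro _ rfl
        ext m
        simp
      rw [this _ h, sub_self, norm_zero]
      positivity
    · rw [iteratedFDeriv_const_of_ne hi.ne']
      simp only [Pi.zero_apply, sub_self, norm_zero]
      positivity

lemma holder_mono {σ τ : ℝ} (F : U → V) (hτ : (⌊τ⌋₊ : ℝ) = τ) (h : ⌊τ⌋₊ ≤ ⌊σ⌋₊) :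
    holderNormOn τ univ F ≤ holderNormOn σ univ F := by
  rw [holderNormOn, if_pos hτ, add_zero]
  unfold cNormOn
  refine iSup_le fun i => iSup₂_le fun x _ => ?_
  rw [iteratedFDerivWithin_univ]
  exact holder_ge F (by omega) x

theorem holder_comp (σ : ℝ) (hσ : 1 ≤ σ) : ∃ C : ℝ, 0 ≤ C ∧
    ∀ {U V : Type u1} {W : Type u1} [NormedAddCommGroup U] [NormedSpace ℝ U]
      [NormedAddCommGroup V] [NormedSpace ℝ V] [NormedAddCommGroup W] [NormedSpace ℝ W]
      (F : V → W) (G : U → V), HolderOn σ univ F → HolderOn σ univ G →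
      HolderOn σ univ (fun q => F (G q)) ∧
      holderNormOn σ univ (fun q => F (G q)) ≤ ENNReal.ofReal C *
        (holderNormOn σ univ F * (holderNormOn 1 univ G) ^ σ
          + holderNormOn 1 univ F * holderNormOn σ univ G + holderNormOn 0 univ F) := by
  obtain ⟨C, hC, main⟩ := aux_real.{u1} σ hσ
  refine ⟨2 * C + 2, by positivity, ?_⟩
  intro U V W _ _ _ _ _ _ F G hF hG
  have hk : 1 ≤ ⌊σ⌋₊ := Nat.one_le_floor_iff _ |>.2 hσ
  have hF1 : holderNormOn 1 univ F ≤ holderNormOn σ univ F := holder_mono F (by simp) (by simpa)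
  have hG1 : holderNormOn 1 univ G ≤ holderNormOn σ univ G := holder_mono G (by simp) (by simpa)
  have hF0 : holderNormOn 0 univ F ≤ holderNormOn σ univ F := holder_mono F (by simp) (by simp)
  have tFσ := hF.2.ne
  have tGσ := hG.2.ne
  have tF1 := (hF1.trans_lt hF.2).ne
  have tG1 := (hG1.trans_lt hG.2).ne
  have tF0 := (hF0.trans_lt hF.2).ne
  have cF : ContDiff ℝ ⌊σ⌋₊ F := contDiffOn_univ.1 hF.1
  have cG : ContDiff ℝ ⌊σ⌋₊ G := contDiffOn_univ.1 hG.1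
  have key : holderNormOn σ univ (fun q => F (G q)) ≤ ENNReal.ofReal (2 * C + 2) *
        (holderNormOn σ univ F * (holderNormOn 1 univ G) ^ σ
          + holderNormOn 1 univ F * holderNormOn σ univ G + holderNormOn 0 univ F) := by
    have fl1 : (1 : ℕ) ≤ ⌊(1:ℝ)⌋₊ := by simp
    have hM : ∀ x, ‖F x‖ ≤ (holderNormOn 0 univ F).toReal := fun x => by
      have := holder_ge' tF0 (i := 0) (by simp) x
      rwa [norm_iteratedFDeriv_zero] at this
    have hconst : ∀ c, (∀ q, F (G q) = c) → holderNormOn σ univ (fun q => F (G q)) ≤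
        ENNReal.ofReal (2 * C + 2) *
        (holderNormOn σ univ F * (holderNormOn 1 univ G) ^ σ
          + holderNormOn 1 univ F * holderNormOn σ univ G + holderNormOn 0 univ F) := by
      intro c hc
      have : (fun q => F (G q)) = fun _ => c := funext hc
      rw [this]
      refine (holder_const c).trans ?_
      calc ENNReal.ofReal (2 * ‖c‖) ≤ ENNReal.ofReal ((2 * C + 2) * (holderNormOn 0 univ F).toReal) := by
            refine ENNReal.ofReal_le_ofReal ?_
            have h0 := hM (G 0)
            rw [hc] at h0
            have : 0 ≤ C * (holderNormOn 0 univ F).toReal := by positivity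
            nlinarith
        _ = ENNReal.ofReal (2 * C + 2) * holderNormOn 0 univ F := by
            rw [ENNReal.ofReal_mul (by positivity), ENNReal.ofReal_toReal tF0]
        _ ≤ _ := by
            gcongr
            exact le_add_self
    by_cases ha : holderNormOn 1 univ F = 0
    · refine hconst 0 fun q => ?_
      have := holder_ge' tF1 (i := 0) (by simp) (G q)
      rw [norm_iteratedFDeriv_zero, ha] at this
      simpa using this
    by_cases hb : holderNormOn 1 univ G = 0
    · refine hconst (F 0) fun q => ?_
      have := holder_ge' tG1 (i := 0) (by simp) q
      rw [norm_iteratedFDeriv_zero, hb] at this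
      have : G q = 0 := by simpa using this
      rw [this]
    have ha' : 0 < (holderNormOn 1 univ F).toReal := ENNReal.toReal_pos ha tF1
    have hb' : 0 < (holderNormOn 1 univ G).toReal := ENNReal.toReal_pos hb tG1
    have hP' := ha'.trans_le (ENNReal.toReal_mono tFσ hF1)
    have hQ' := hb'.trans_le (ENNReal.toReal_mono tGσ hG1)
    have hM0 : 0 ≤ (holderNormOn 0 univ F).toReal := ENNReal.toReal_nonneg
    obtain ⟨r1, r2⟩ := main F G _ _ _ _ _ ha' hb' hP' hQ' cF cG
      (fun i hi => holder_ge' tFσ hi) (fun i hi => holder_ge' tGσ hi) hM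
      (fun x => holder_ge' tF1 fl1 x) (fun x => holder_ge' tG1 fl1 x)
      (holder_ge_top tFσ) (holder_ge_top tGσ)
    refine (holder_le (by positivity) r1 r2).trans ?_
    have e : holderNormOn σ univ F * (holderNormOn 1 univ G) ^ σ
          + holderNormOn 1 univ F * holderNormOn σ univ G + holderNormOn 0 univ F
        = ENNReal.ofReal ((holderNormOn σ univ F).toReal * (holderNormOn 1 univ G).toReal ^ σ
          + (holderNormOn 1 univ F).toReal * (holderNormOn σ univ G).toReal
          + (holderNormOn 0 univ F).toReal) := by
      rw [ENNReal.ofReal_add (by positivity) hM0, ENNReal.ofReal_add (by positivity) (by positivity),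
        ENNReal.ofReal_mul hP'.le, ENNReal.ofReal_mul ha'.le,
        ← ENNReal.ofReal_rpow_of_pos hb', ENNReal.ofReal_toReal tFσ,
        ENNReal.ofReal_toReal tF1, ENNReal.ofReal_toReal tG1, ENNReal.ofReal_toReal tGσ,
        ENNReal.ofReal_toReal tF0]
    rw [e, ← ENNReal.ofReal_mul (by positivity)]
    refine ENNReal.ofReal_le_ofReal ?_
    rw [← mul_assoc]
    gcongr
    linarith
  refine ⟨⟨contDiffOn_univ.2 (cF.comp cG), key.trans_lt ?_⟩, key⟩
  refine ENNReal.mul_lt_top ENNReal.ofReal_lt_top ?_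
  refine ENNReal.add_lt_top.2 ⟨ENNReal.add_lt_top.2 ⟨ENNReal.mul_lt_top hF.2 ?_,
    ENNReal.mul_lt_top tF1.lt_top hG.2⟩, tF0.lt_top⟩
  exact ENNReal.rpow_lt_top_of_nonneg (by linarith) tG1

end Aux

lemma w1_ge (l t : ℝ) : 1 ≤ w1 l t := by
  unfold w1
  split_ifs
  · exact le_rfl
  · have : 0 ≤ |t| ^ l := by positivity
    linarith

lemma w1_add {l m : ℝ} (t : ℝ) (hl : l = 0 ∨ 1 ≤ l) (hm : m = 0 ∨ 1 ≤ m) :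
    w1 (l + m) t ≤ w1 l t * w1 m t := by
  rcases hl with rfl | hl
  · simp [w1]
  rcases hm with rfl | hm
  · simp [w1]
  rw [w1, w1, w1, if_neg (by linarith), if_neg (by linarith), if_neg (by linarith),
    Real.rpow_add_of_nonneg (abs_nonneg t) (by linarith) (by linarith)]
  have h1 : 0 ≤ |t| ^ l := by positivity
  have h2 : 0 ≤ |t| ^ m := by positivity
  nlinarith

lemma w2_add {l m : ℝ} (t : ℝ) (hl : l = 0 ∨ 1 ≤ l) (hm : m = 0 ∨ 1 ≤ m) :
    w2 (l + m) t ≤ 2 * (w1 l t * w2 m t) := by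
  rcases hl with rfl | hl
  · have : 0 ≤ w2 m t := by
      unfold w2
      split_ifs
      · exact zero_le_one
      · positivity
    simp only [zero_add, w1, if_true, one_mul]
    linarith
  rcases hm with rfl | hm
  · simp only [add_zero, w1, w2, if_true, mul_one]
    rw [if_neg (by linarith), if_neg (by linarith)]
    have h1 : 0 ≤ |t| ^ l := by positivity
    rcases le_total |t| 1 with h | h
    · have := Real.rpow_le_one (abs_nonneg t) h (z := l - 1) (by linarith)
      linarith
    · have := Real.rpow_le_rpow_of_exponent_le h (y := l - 1) (z := l) (by linarith)
      linarith
  rw [w1, w2, w2, if_neg (by linarith), if_neg (by linarith), if_neg (by linarith),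
    show l + m - 1 = l + (m - 1) by ring,
    Real.rpow_add_of_nonneg (abs_nonneg t) (by linarith) (by linarith)]
  have h1 : 0 ≤ |t| ^ l := by positivity
  have h2 : 0 ≤ |t| ^ (m - 1) := by positivity
  nlinarith

lemma wnormD_ge1 (σ l : ℝ) (A : Set (E n)) (f : E n → E n → ℝ → F) {p : E n} (hp : p ∈ A)
    (t : ℝ) : holderNormOn σ univ (fun q => f q p t) * ENNReal.ofReal (w1 l t)
      ≤ wnormD σ l A f := by
  refine le_trans ?_ le_self_add
  exact le_iSup₂_of_le p hp (le_iSup_of_le t le_rfl)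

lemma wnormD_ge2 (σ l : ℝ) (A : Set (E n)) (f : E n → E n → ℝ → F)
    (t : ℝ) : lipT A f t * ENNReal.ofReal (w2 l t) ≤ wnormD σ l A f := by
  refine le_trans ?_ le_add_self
  exact le_iSup_of_le t le_rfl

lemma lipT_comp {σ : ℝ} (hσ : 1 ≤ σ) {A : Set (E n)} {f : E n → E n → ℝ → ℝ}
    {g : E n → E n → ℝ → E n} (t : ℝ)
    (hf : ∀ p ∈ A, HolderOn σ univ fun q => f q p t) :
    lipT A (fun q p t => f (g q p t) p t) t
      ≤ (⨆ p ∈ A, holderNormOn 1 univ (fun q => f q p t)) * lipT A g t + lipT A f t := by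
  have hk : 1 ≤ ⌊σ⌋₊ := Nat.one_le_floor_iff _ |>.2 hσ
  unfold lipT
  rw [mul_add]
  refine le_trans (add_le_add (b := (⨆ p ∈ A, holderNormOn 1 univ (fun q => f q p t)) *
      (⨆ q : E n, ⨆ x ∈ A, ⨆ y ∈ A, ⨆ _ : x ≠ y, ENNReal.ofReal (‖g q x t - g q y t‖ / ‖x - y‖))
      + (⨆ q : E n, ⨆ x ∈ A, ⨆ y ∈ A, ⨆ _ : x ≠ y,
        ENNReal.ofReal (‖f q x t - f q y t‖ / ‖x - y‖)))
      (d := ⨆ q : E n, ⨆ p ∈ A, (‖f q p t‖₊ : ℝ≥0∞)) ?_ ?_) ?_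
  · refine iSup_le fun q => iSup₂_le fun x hx => iSup₂_le fun y hy => iSup_le fun hxy => ?_
    have hd : 0 < ‖x - y‖ := norm_pos_iff.2 (sub_ne_zero.2 hxy)
    have hF1 : holderNormOn 1 univ (fun q => f q x t) ≤ holderNormOn σ univ (fun q => f q x t) :=
      holder_mono _ (by simp) (by simpa)
    have hF1t := (hF1.trans_lt (hf x hx).2).ne
    have hlip := aux_lip0 hk (contDiffOn_univ.1 (hf x hx).1)
      (fun z => holder_ge' hF1t (i := 1) (by simp) z) (g q x t) (g q y t)
    set c := (holderNormOn 1 univ (fun q => f q x t)).toReal with hc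
    have hc0 : 0 ≤ c := ENNReal.toReal_nonneg
    have tri : ‖f (g q x t) x t - f (g q y t) y t‖ / ‖x - y‖
        ≤ c * (‖g q x t - g q y t‖ / ‖x - y‖)
          + ‖f (g q y t) x t - f (g q y t) y t‖ / ‖x - y‖ := by
      rw [← mul_div_assoc, ← add_div]
      gcongr
      refine (norm_sub_le_norm_sub_add_norm_sub _ (f (g q y t) x t) _).trans ?_
      gcongr
    refine (ENNReal.ofReal_le_ofReal tri).trans ?_
    rw [ENNReal.ofReal_add (by positivity) (by positivity), ENNReal.ofReal_mul hc0, hc,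
      ENNReal.ofReal_toReal hF1t]
    refine add_le_add (mul_le_mul' ?_ ?_) ?_
    · exact le_iSup₂_of_le (f := fun p (_ : p ∈ A) => holderNormOn 1 univ (fun q => f q p t))
        x hx le_rfl
    · exact le_iSup_of_le q (le_iSup₂_of_le x hx (le_iSup₂_of_le y hy (le_iSup_of_le hxy le_rfl)))
    · exact le_iSup_of_le (g q y t)
        (le_iSup₂_of_le x hx (le_iSup₂_of_le y hy (le_iSup_of_le hxy le_rfl)))
  · refine iSup_le fun q => iSup₂_le fun p hp => ?_
    exact le_iSup_of_le (g q p t) (le_iSup₂_of_le p hp le_rfl)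
  · rw [add_assoc]
    gcongr
    exact le_self_add

/-- **Composition estimate for the weighted Lipschitz norms (Proposition 3.3.d).** -/
theorem wnormD_comp
    (n : ℕ) (σ : ℝ) (hσ : 1 ≤ σ) :
    ∃ C : ℝ, 0 < C ∧
    ∀ (A : Set (E n)) (l m : ℝ) (f : E n → E n → ℝ → ℝ) (g : E n → E n → ℝ → E n),
      IsClosed A →
      (l = 0 ∨ 1 ≤ l) → (m = 0 ∨ 1 ≤ m) →
      MemD σ A f → MemD σ A g →
      MemD σ A (fun q p t => f (g q p t) p t) ∧
      wnormD σ (l + m) A (fun q p t => f (g q p t) p t)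
        ≤ ENNReal.ofReal C *
          (wnormD σ l A f * (wnormD 1 m A g) ^ σ
            + wnormD 1 l A f * wnormD σ m A g
            + wnormD 0 (l + m) A f) := by
  obtain ⟨C, hC, main⟩ := holder_comp.{0} σ hσ
  refine ⟨C + 2, by positivity, ?_⟩
  intro A l m f g hA hl hm hf hg
  have hH : ∀ p ∈ A, ∀ t : ℝ, _ := fun p hp t =>
    main (fun q => f q p t) (fun q => g q p t) (hf.2.2 p hp t) (hg.2.2 p hp t)
  refine ⟨⟨?_, ?_, fun p hp t => (hH p hp t).1⟩, ?_⟩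
  · have h1 : ContinuousOn (fun x : E n × E n × ℝ => (g x.1 x.2.1 x.2.2, x.2.1, x.2.2))
        (univ ×ˢ (A ×ˢ univ)) := hg.1.prodMk (by fun_prop)
    exact hf.1.comp h1 fun x hx => ⟨mem_univ _, hx.2⟩
  · intro q p t k
    simp only [hg.2.1 q p t k]
  set T1 := wnormD σ l A f * (wnormD 1 m A g) ^ σ
  set T2 := wnormD 1 l A f * wnormD σ m A g
  set T3 := wnormD 0 (l + m) A f
  have hsum : ENNReal.ofReal (C + 2) * (T1 + T2 + T3)
      = ENNReal.ofReal C * (T1 + T2 + T3) + 2 * (T1 + T2 + T3) := by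
    rw [ENNReal.ofReal_add hC (by norm_num), add_mul]
    simp
  rw [hsum]
  refine add_le_add ?_ ?_
  · refine iSup₂_le fun p hp => iSup_le fun t => ?_
    have hw : ENNReal.ofReal (w1 (l + m) t)
        ≤ ENNReal.ofReal (w1 l t) * ENNReal.ofReal (w1 m t) := by
      rw [← ENNReal.ofReal_mul (zero_le_one.trans (w1_ge l t))]
      exact ENNReal.ofReal_le_ofReal (w1_add t hl hm)
    have hw' : ENNReal.ofReal (w1 m t) ≤ ENNReal.ofReal (w1 m t) ^ σ := by
      have h1 : 1 ≤ ENNReal.ofReal (w1 m t) := by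
        simpa using ENNReal.ofReal_le_ofReal (w1_ge m t)
      simpa using ENNReal.rpow_le_rpow_of_exponent_le h1 hσ
    refine (mul_le_mul_left (hH p hp t).2 _).trans ?_
    rw [mul_assoc, add_mul, add_mul]
    gcongr
    · calc _ ≤ holderNormOn σ univ (fun q => f q p t) * holderNormOn 1 univ (fun q => g q p t) ^ σ
            * (ENNReal.ofReal (w1 l t) * ENNReal.ofReal (w1 m t) ^ σ) := by
              gcongr
              exact hw.trans (by gcongr)
        _ = (holderNormOn σ univ (fun q => f q p t) * ENNReal.ofReal (w1 l t)) *
            (holderNormOn 1 univ (fun q => g q p t) * ENNReal.ofReal (w1 m t)) ^ σ := by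
              rw [ENNReal.mul_rpow_of_nonneg _ _ (by linarith)]
              ring
        _ ≤ T1 := by
              have h1 := wnormD_ge1 σ l A f hp t
              have h2 := wnormD_ge1 1 m A g hp t
              exact mul_le_mul' h1 (ENNReal.rpow_le_rpow h2 (by linarith))
    · calc _ ≤ holderNormOn 1 univ (fun q => f q p t) * holderNormOn σ univ (fun q => g q p t)
            * (ENNReal.ofReal (w1 l t) * ENNReal.ofReal (w1 m t)) := by
              gcongr
        _ = (holderNormOn 1 univ (fun q => f q p t) * ENNReal.ofReal (w1 l t)) *
            (holderNormOn σ univ (fun q => g q p t) * ENNReal.ofReal (w1 m t)) := by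
              ring
        _ ≤ T2 := mul_le_mul' (wnormD_ge1 1 l A f hp t) (wnormD_ge1 σ m A g hp t)
    · exact wnormD_ge1 0 (l + m) A f hp t
  · refine iSup_le fun t => ?_
    refine (mul_le_mul_left (lipT_comp hσ t (fun p hp => hf.2.2 p hp t)) _).trans ?_
    rw [add_mul]
    have hw : ENNReal.ofReal (w2 (l + m) t)
        ≤ 2 * (ENNReal.ofReal (w1 l t) * ENNReal.ofReal (w2 m t)) := by
      rw [← ENNReal.ofReal_mul (zero_le_one.trans (w1_ge l t))]
      refine (ENNReal.ofReal_le_ofReal (w2_add t hl hm)).trans ?_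
      rw [ENNReal.ofReal_mul (by norm_num)]
      simp
    have hS : (⨆ p ∈ A, holderNormOn 1 univ (fun q => f q p t)) * ENNReal.ofReal (w1 l t)
        ≤ wnormD 1 l A f := by
      simp only [ENNReal.iSup_mul]
      exact iSup₂_le fun p hp => wnormD_ge1 1 l A f hp t
    have a1 : (⨆ p ∈ A, holderNormOn 1 univ (fun q => f q p t)) * lipT A g t
        * ENNReal.ofReal (w2 (l + m) t) ≤ 2 * T2 := by
      calc _ ≤ (⨆ p ∈ A, holderNormOn 1 univ (fun q => f q p t)) * lipT A g t
            * (2 * (ENNReal.ofReal (w1 l t) * ENNReal.ofReal (w2 m t))) := by gcongr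
        _ = 2 * (((⨆ p ∈ A, holderNormOn 1 univ (fun q => f q p t)) * ENNReal.ofReal (w1 l t))
            * (lipT A g t * ENNReal.ofReal (w2 m t))) := by ring
        _ ≤ 2 * T2 := by
            gcongr
            exact mul_le_mul' hS (wnormD_ge2 σ m A g t)
    have a2 : lipT A f t * ENNReal.ofReal (w2 (l + m) t) ≤ T3 := wnormD_ge2 0 (l + m) A f t
    calc _ ≤ 2 * T2 + T3 := add_le_add a1 a2
      _ ≤ 2 * T2 + 2 * T3 := by
          gcongr
          exact le_mul_of_one_le_left zero_le (by norm_num)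
      _ ≤ 2 * (T1 + T2 + T3) := by
          rw [mul_add, mul_add]
          gcongr
          exact le_add_self

end Bias
end
end
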